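/- arXiv:1910.02832 — 2 statements merged into one kernel-verified Lean document; each statement's English description precedes it below -/
import Mathlib

section
/- Let F ∈ ℤ[t] be an irreducible polynomial of degree g ≥ 2. There exist constants D ≥ 2 and K > 0, depending only on F, such that for every real η > 0 and every real z ≥ 100: ∑_{ℓ} L(ℓ; η) ρ(ℓ)/(φ_F(ℓ) · (log(P⁺(ℓ) + z^{3/4}/ℓ))²) ≤ (K/(log z)²) · ∑_{a ∈ 𝒫(D, z)} L(a; η) ρ(a)/φ_F(a), where the left-hand sum runs over all positive integers ℓ (not necessarily squarefree) with P⁻(ℓ) > D and P⁺(ℓ) ≤ z. -/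
open Real MeasureTheory
open scoped Classical

/-- number of residues n mod d with F(n) ≡ 0 (mod d) -/
noncomputable def polyRho (F : Polynomial ℤ) (d : ℕ) : ℕ :=
  ((Finset.range d).filter (fun n => (d : ℤ) ∣ F.eval (n : ℤ))).card

/-- H_F(x,y,z): number of positive n ≤ x with F(n) having a divisor in (y,z] -/
noncomputable def polyH (F : Polynomial ℤ) (x y z : ℝ) : ℕ :=
  {n : ℕ | 0 < n ∧ (n : ℝ) ≤ x ∧
    ∃ d : ℕ, 0 < d ∧ (d : ℤ) ∣ F.eval (n : ℤ) ∧ y < (d : ℝ) ∧ (d : ℝ) ≤ z}.ncard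

/-- H(x,y,z): number of positive n ≤ x having a divisor in (y,z] -/
noncomputable def Hdiv (x y z : ℝ) : ℕ :=
  {n : ℕ | 0 < n ∧ (n : ℝ) ≤ x ∧
    ∃ d : ℕ, 0 < d ∧ d ∣ n ∧ y < (d : ℝ) ∧ (d : ℝ) ≤ z}.ncard

/-- L(a;σ) -/
noncomputable def Lfun (a : ℕ) (σ : ℝ) : ℝ :=
  (volume {x : ℝ | ∃ d : ℕ, d ∣ a ∧ Real.exp x < (d : ℝ) ∧ (d : ℝ) ≤ Real.exp (x + σ)}).toReal

/-- W(a;σ): ordered pairs of divisors near each other -/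
noncomputable def Wfun (a : ℕ) (σ : ℝ) : ℕ :=
  {p : ℕ × ℕ | p.1 ∣ a ∧ p.2 ∣ a ∧ |Real.log ((p.1 : ℝ) / (p.2 : ℝ))| ≤ σ}.ncard

/-- 𝒫(s,t): squarefree integers with all prime factors in (s,t] -/
def Psf (s t : ℝ) : Set ℕ :=
  {a : ℕ | 0 < a ∧ Squarefree a ∧ ∀ p : ℕ, p.Prime → p ∣ a → s < (p : ℝ) ∧ (p : ℝ) ≤ t}

/-- φ_F(n) = n ∏_{p|n} (1 - ρ(p)/p) -/
noncomputable def polyPhi (F : Polynomial ℤ) (n : ℕ) : ℝ :=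
  (n : ℝ) * ∏ p ∈ n.primeFactors, (1 - (polyRho F p : ℝ) / p)

/-- P⁺(n): largest prime factor, P⁺(1)=0 -/
def Pplus (n : ℕ) : ℕ := n.primeFactors.sup id

/-- h(n;X): least prime q with ∏_{p^ν ∥ n, p ≤ q} p^ν > √X -/
noncomputable def hfun (n : ℕ) (X : ℝ) : ℕ :=
  sInf {q : ℕ | q.Prime ∧
    Real.sqrt X < ∏ p ∈ n.primeFactors.filter (fun p => p ≤ q), (p : ℝ) ^ (n.factorization p)}


theorem polyRho_eq_card_range (F : Polynomial ℤ) (d : ℕ) :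
    polyRho F d = ((Finset.range d).filter fun n : ℕ => (d : ℤ) ∣ F.eval (n : ℤ)).card := by
  unfold polyRho
  have : (do let a ← Finset.range d; pure (a : ℤ) : Finset ℤ) =
      (Finset.range d).image (fun a : ℕ => (a : ℤ)) := by
    ext x
    simp [eq_comm]
  rw [this, Finset.filter_image, Finset.card_image_of_injective _ Nat.cast_injective]

theorem polyRho_one (F : Polynomial ℤ) : polyRho F 1 = 1 := by
  simp [polyRho_eq_card_range]

theorem dvd_eval_mod_iff (F : Polynomial ℤ) {d m : ℕ} (h : d ∣ m) (n : ℕ) :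
    (d : ℤ) ∣ F.eval ((n % m : ℕ) : ℤ) ↔ (d : ℤ) ∣ F.eval (n : ℤ) := by
  have h1 : ((n % m : ℕ) : ℤ) ≡ n [ZMOD d] := by
    rw [Int.natCast_modEq_iff]
    exact (Nat.mod_modEq n m).of_dvd h
  have h2 : (d : ℤ) ∣ F.eval (n : ℤ) - F.eval ((n % m : ℕ) : ℤ) :=
    h1.dvd.trans (Polynomial.sub_dvd_eval_sub _ _ F)
  rw [← dvd_iff_dvd_of_dvd_sub h2]

theorem polyRho_mul (F : Polynomial ℤ) {m n : ℕ} (hm : 0 < m) (hn : 0 < n)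
    (h : m.Coprime n) : polyRho F (m * n) = polyRho F m * polyRho F n := by
  simp only [polyRho_eq_card_range]
  rw [← Finset.card_product]
  refine Finset.card_nbij' (fun k => (k % m, k % n))
    (fun q => Nat.chineseRemainder h q.1 q.2) ?_ ?_ ?_ ?_
  · intro k hk
    simp only [Finset.coe_filter, Finset.mem_range, Set.mem_ofPred_eq, Nat.cast_mul] at hk
    simp only [Finset.coe_product, Set.mem_prod, Finset.coe_filter, Finset.mem_range,
      Set.mem_ofPred_eq, dvd_eval_mod_iff F dvd_rfl]
    exact ⟨⟨Nat.mod_lt _ hm, (Dvd.intro _ rfl).trans hk.2⟩,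
      ⟨Nat.mod_lt _ hn, (Dvd.intro_left _ rfl).trans hk.2⟩⟩
  · rintro ⟨a, b⟩ hab
    simp only [Finset.coe_product, Set.mem_prod, Finset.coe_filter, Finset.mem_range,
      Set.mem_ofPred_eq] at hab
    obtain ⟨⟨ha, ha'⟩, hb, hb'⟩ := hab
    simp only [Finset.coe_filter, Finset.mem_range, Set.mem_ofPred_eq, Nat.cast_mul]
    refine ⟨Nat.chineseRemainder_lt_mul h a b hm.ne' hn.ne', ?_⟩
    have h1 := (Nat.chineseRemainder h a b).2.1
    have h2 := (Nat.chineseRemainder h a b).2.2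
    apply IsCoprime.mul_dvd (Nat.isCoprime_iff_coprime.mpr h)
    · rw [← dvd_eval_mod_iff F dvd_rfl, h1, dvd_eval_mod_iff F dvd_rfl]; exact ha'
    · rw [← dvd_eval_mod_iff F dvd_rfl, h2, dvd_eval_mod_iff F dvd_rfl]; exact hb'
  · intro k hk
    simp only [Finset.coe_filter, Finset.mem_range, Set.mem_ofPred_eq] at hk
    have := Nat.chineseRemainder_modEq_unique h (a := k % m) (b := k % n) (z := k)
      (Nat.mod_modEq _ _).symm (Nat.mod_modEq _ _).symm
    exact (this.eq_of_lt_of_lt hk.1 (Nat.chineseRemainder_lt_mul h _ _ hm.ne' hn.ne')).symm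
  · rintro ⟨a, b⟩ hab
    simp only [Finset.coe_product, Set.mem_prod, Finset.coe_filter, Finset.mem_range,
      Set.mem_ofPred_eq] at hab
    have h1 := (Nat.chineseRemainder h a b).2.1
    have h2 := (Nat.chineseRemainder h a b).2.2
    simp only [Prod.mk.injEq]
    exact ⟨Eq.trans h1 (Nat.mod_eq_of_lt hab.1.1), Eq.trans h2 (Nat.mod_eq_of_lt hab.2.1)⟩

/-- A polynomial has at most as many roots modulo a prime as its degree, once the prime does not
divide the leading coefficient. -/
theorem polyRho_prime_le_natDegree (F : Polynomial ℤ) {p : ℕ} (hp : p.Prime)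
    (h : ¬ (p : ℤ) ∣ F.leadingCoeff) : polyRho F p ≤ F.natDegree := by
  have := Fact.mk hp
  set G := F.map (Int.castRingHom (ZMod p)) with hG
  have hG0 : G ≠ 0 := by
    intro h0
    apply h
    have := congrArg (fun P => Polynomial.coeff P F.natDegree) h0
    simp only [hG, Polynomial.coeff_map, Polynomial.coeff_zero] at this
    exact (ZMod.intCast_zmod_eq_zero_iff_dvd _ _).mp (by simpa using this)
  calc polyRho F p ≤ G.roots.toFinset.card := by
        rw [polyRho_eq_card_range]
        refine Finset.card_le_card_of_injOn (fun n => (n : ZMod p)) ?_ ?_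
        · intro n hn
          simp only [Finset.coe_filter, Finset.mem_range, Set.mem_ofPred_eq] at hn
          simp only [Finset.mem_coe, Multiset.mem_toFinset, Polynomial.mem_roots hG0,
            Polynomial.IsRoot.def]
          have := (ZMod.intCast_zmod_eq_zero_iff_dvd _ _).mpr hn.2
          rw [hG, Polynomial.eval_natCast_map]
          simpa using this
        · intro a ha b hb hab
          simp only [Finset.coe_filter, Finset.mem_range, Set.mem_ofPred_eq] at ha hb
          exact ((ZMod.natCast_eq_natCast_iff _ _ _).mp hab).eq_of_lt_of_lt ha.1 hb.1
    _ ≤ G.roots.card := Multiset.toFinset_card_le _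
    _ ≤ G.natDegree := Polynomial.card_roots' _
    _ ≤ F.natDegree := Polynomial.natDegree_map_le

/-- Simple roots modulo a prime lift in at most one way modulo a power of that prime. -/
theorem polyRho_prime_pow_le (F A B : Polynomial ℤ) {R : ℤ}
    (hR : F * A + F.derivative * B = Polynomial.C R) {p : ℕ} (hp : p.Prime)
    (h : ¬ (p : ℤ) ∣ R) {k : ℕ} (hk : 0 < k) : polyRho F (p ^ k) ≤ polyRho F p := by
  simp only [polyRho_eq_card_range]
  refine Finset.card_le_card_of_injOn (fun n => n % p) ?_ ?_
  · intro n hn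
    simp only [Finset.coe_filter, Finset.mem_range, Set.mem_ofPred_eq] at hn ⊢
    refine ⟨Nat.mod_lt _ hp.pos, (dvd_eval_mod_iff F dvd_rfl n).mpr (dvd_trans ?_ hn.2)⟩
    exact_mod_cast dvd_pow_self p hk.ne'
  · intro a ha b hb hab
    simp only [Finset.coe_filter, Finset.mem_range, Set.mem_ofPred_eq] at ha hb
    push_cast at ha hb
    have hpZ : Prime (p : ℤ) := Nat.prime_iff_prime_int.mp hp
    have hab' : (p : ℤ) ∣ (b : ℤ) - a := (Int.natCast_modEq_iff.mpr hab).dvd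
    obtain ⟨c, hc⟩ := Polynomial.binomExpansion F (a : ℤ) ((b : ℤ) - a)
    have hFa : (p : ℤ) ∣ F.eval (a : ℤ) := (dvd_pow_self _ hk.ne').trans ha.2
    have hd : ¬ (p : ℤ) ∣ F.derivative.eval (a : ℤ) := by
      intro hd
      apply h
      have := congrArg (Polynomial.eval (a : ℤ)) hR
      simp only [Polynomial.eval_add, Polynomial.eval_mul, Polynomial.eval_C] at this
      rw [← this]
      exact dvd_add (hFa.mul_right _) (hd.mul_right _)
    have hu : ¬ (p : ℤ) ∣ F.derivative.eval (a : ℤ) + c * ((b : ℤ) - a) := fun hu =>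
      hd ((dvd_add_left (hab'.mul_left c)).mp hu)
    have hprod : (p : ℤ) ^ k ∣
        (F.derivative.eval (a : ℤ) + c * ((b : ℤ) - a)) * ((b : ℤ) - a) := by
      have : (F.derivative.eval (a : ℤ) + c * ((b : ℤ) - a)) * ((b : ℤ) - a) =
          F.eval (b : ℤ) - F.eval (a : ℤ) := by
        have e : (a : ℤ) + (b - a) = b := by ring
        rw [e] at hc
        rw [hc]; ring
      rw [this]
      exact dvd_sub hb.2 ha.2
    have hcop : IsCoprime ((p : ℤ) ^ k) (F.derivative.eval (a : ℤ) + c * ((b : ℤ) - a)) :=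
      ((Prime.coprime_iff_not_dvd hpZ).mpr hu).pow_left
    have := hcop.dvd_of_dvd_mul_left hprod
    have h3 : a ≡ b [MOD p ^ k] := by
      rw [← Int.natCast_modEq_iff]
      exact Int.modEq_iff_dvd.mpr (by exact_mod_cast this)
    exact h3.eq_of_lt_of_lt ha.1 hb.1

/-- An irreducible integer polynomial and its derivative generate a nonzero integer. -/
theorem exists_bezout_derivative (F : Polynomial ℤ) (hF : Irreducible F)
    (hdeg : F.natDegree ≠ 0) :
    ∃ (A B : Polynomial ℤ) (R : ℤ), R ≠ 0 ∧
      F * A + F.derivative * B = Polynomial.C R := by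
  obtain ⟨A, B, -, -, h⟩ := Polynomial.exists_mul_add_mul_eq_C_resultant F F.derivative
    le_rfl le_rfl (Or.inl hdeg)
  refine ⟨A, B, _, ?_, h⟩
  have hprim : F.IsPrimitive := hF.isPrimitive hdeg
  have hirr := (Polynomial.IsPrimitive.Int.irreducible_iff_irreducible_map_cast hprim).mp hF
  have hsep : (F.map (Int.castRingHom ℚ)).Separable := hirr.separable
  unfold Polynomial.Separable at hsep
  rw [Polynomial.derivative_map] at hsep
  have hne := Polynomial.resultant_ne_zero _ _ hsep
  have hinj : Function.Injective (Int.castRingHom ℚ) := Int.cast_injective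
  rw [Polynomial.natDegree_map_eq_of_injective hinj,
    Polynomial.natDegree_map_eq_of_injective hinj, Polynomial.resultant_map_map] at hne
  intro h0
  exact hne (by rw [h0]; simp)

/-- The set whose measure is `Lfun a σ`. -/
def nearDivisorSet (a : ℕ) (σ : ℝ) : Set ℝ :=
  {x : ℝ | ∃ d : ℕ, d ∣ a ∧ Real.exp x < (d : ℝ) ∧ (d : ℝ) ≤ Real.exp (x + σ)}

theorem nearDivisorSet_subset {a : ℕ} (ha : 0 < a) (σ : ℝ) :
    nearDivisorSet a σ ⊆ Set.Icc (-σ) (Real.log a) := by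
  rintro x ⟨d, hd, h1, h2⟩
  have hd1 : (1 : ℝ) ≤ d := by exact_mod_cast Nat.pos_of_dvd_of_pos hd ha
  have hda : (d : ℝ) ≤ a := by exact_mod_cast Nat.le_of_dvd ha hd
  constructor
  · have : (0 : ℝ) ≤ x + σ := Real.one_le_exp_iff.mp (hd1.trans h2)
    linarith
  · rw [Real.le_log_iff_exp_le (by exact_mod_cast ha)]
    linarith

theorem volume_nearDivisorSet_ne_top {a : ℕ} (ha : 0 < a) (σ : ℝ) :
    volume (nearDivisorSet a σ) ≠ ⊤ :=
  measure_ne_top_of_subset (nearDivisorSet_subset ha σ) (by simp)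

theorem Lfun_nonneg (a : ℕ) (σ : ℝ) : 0 ≤ Lfun a σ := ENNReal.toReal_nonneg

theorem Lfun_prime_pow_mul_le {p m : ℕ} (hp : p.Prime) (hm : 0 < m) (j : ℕ) (σ : ℝ) :
    Lfun (p ^ j * m) σ ≤ (j + 1) * Lfun m σ := by
  have hsub : nearDivisorSet (p ^ j * m) σ ⊆
      ⋃ i ∈ Finset.range (j + 1), (fun x => x - i * Real.log p) ⁻¹' nearDivisorSet m σ := by
    rintro x ⟨d, hd, h1, h2⟩
    obtain ⟨u, v, hu, hv, rfl⟩ := (Nat.dvd_mul).mp hd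
    obtain ⟨i, hi, rfl⟩ := (Nat.dvd_prime_pow hp).mp hu
    simp only [Set.mem_iUnion, Finset.mem_range, Set.mem_preimage]
    have hp0 : (0 : ℝ) < (p : ℝ) ^ i := pow_pos (by exact_mod_cast hp.pos) i
    have hexp : Real.exp (i * Real.log p) = (p : ℝ) ^ i := by
      rw [← Real.log_pow, Real.exp_log hp0]
    push_cast at h1 h2
    refine ⟨i, by omega, v, hv, ?_, ?_⟩
    · rw [Real.exp_sub, hexp, div_lt_iff₀ hp0]; linarith
    · rw [show x - i * Real.log p + σ = x + σ - i * Real.log p by ring, Real.exp_sub, hexp,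
        le_div_iff₀ hp0]
      linarith
  have hle : volume (nearDivisorSet (p ^ j * m) σ) ≤
      (j + 1 : ℕ) * volume (nearDivisorSet m σ) :=
    calc volume (nearDivisorSet (p ^ j * m) σ)
        ≤ volume (⋃ i ∈ Finset.range (j + 1),
            (fun x => x - i * Real.log p) ⁻¹' nearDivisorSet m σ) := measure_mono hsub
      _ ≤ ∑ i ∈ Finset.range (j + 1),
            volume ((fun x => x - i * Real.log p) ⁻¹' nearDivisorSet m σ) :=
          measure_biUnion_finset_le _ _
      _ = ∑ _i ∈ Finset.range (j + 1), volume (nearDivisorSet m σ) := by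
          simp only [sub_eq_add_neg, measure_preimage_add_right]
      _ = (j + 1 : ℕ) * volume (nearDivisorSet m σ) := by simp
  have := ENNReal.toReal_mono
    (ENNReal.mul_ne_top (ENNReal.natCast_ne_top _) (volume_nearDivisorSet_ne_top hm σ)) hle
  rw [ENNReal.toReal_mul, ENNReal.toReal_natCast] at this
  simpa [Lfun, nearDivisorSet] using this

/-- Divisors of `p ^ K * N`, sorted by their exponent at a prime `p` not dividing `N`. -/
theorem sum_divisors_prime_pow_mul {p N K : ℕ} (hp : p.Prime) (hpN : ¬ p ∣ N) (G : ℕ → ℝ) :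
    ∑ d ∈ (p ^ K * N).divisors, G d =
      ∑ i ∈ Finset.range (K + 1), ∑ d ∈ N.divisors, G (p ^ i * d) := by
  have hcop : (p ^ K).Coprime N := ((Nat.Prime.coprime_iff_not_dvd hp).mpr hpN).pow_left K
  rw [Nat.divisors_mul, Finset.mul_def, Finset.sum_image
    (by simpa using Nat.Coprime.mul_injOn_divisors hcop), Finset.sum_product,
    Nat.sum_divisors_prime_pow hp]

/-- Extending a sum over squarefree divisors to a sum over all divisors of a high power costs a
factor which is an Euler product over the primes involved. -/
theorem sum_divisors_prod_pow_le {f w L ε : ℕ → ℝ} {K : ℕ} (hK : 1 ≤ K) {P : Finset ℕ}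
    (hP : ∀ p ∈ P, p.Prime)
    (hf1 : f 1 = 1) (hw1 : w 1 = 1)
    (hf0 : ∀ n, n ∣ (∏ p ∈ P, p) ^ K → 0 ≤ f n)
    (hw0 : ∀ n, n ∣ ∏ p ∈ P, p → 0 ≤ w n)
    (hfmul : ∀ m n, 0 < m → 0 < n → m.Coprime n → f (m * n) = f m * f n)
    (hwmul : ∀ m n, 0 < m → 0 < n → m.Coprime n → w (m * n) = w m * w n)
    (hL0 : ∀ n, 0 ≤ L n)
    (hL : ∀ p m j : ℕ, p.Prime → 0 < m → L (p ^ j * m) ≤ (j + 1) * L m)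
    (hwf : ∀ p ∈ P, w p ≤ f p)
    (hε : ∀ p ∈ P, 2 * (f p - w p) + ∑ k ∈ Finset.Ico 2 (K + 1), (k + 1) * f (p ^ k) ≤ ε p)
    {c : ℕ} (hc : 0 < c) :
    ∑ l ∈ ((∏ p ∈ P, p) ^ K).divisors, L (c * l) * f l ≤
      (∏ p ∈ P, (1 + ε p)) * ∑ a ∈ (∏ p ∈ P, p).divisors, L (c * a) * w a := by
  induction P using Finset.induction_on generalizing c with
  | empty => simp [hf1, hw1]
  | insert p P hpP ih =>
    have hp : p.Prime := hP p (Finset.mem_insert_self _ _)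
    set N := ∏ p ∈ P, p with hN
    have hN0 : 0 < N := Finset.prod_pos fun q hq => (hP q (Finset.mem_insert_of_mem hq)).pos
    have hpN : ¬ p ∣ N := by
      intro h
      obtain ⟨q, hq, hpq⟩ := (Prime.dvd_finsetProd_iff hp.prime _).mp h
      exact hpP ((Nat.prime_dvd_prime_iff_eq hp (hP q (Finset.mem_insert_of_mem hq))).mp hpq ▸ hq)
    have hpNK : ¬ p ∣ N ^ K := fun h => hpN (hp.dvd_of_dvd_pow h)
    rw [Finset.prod_insert hpP] at hf0 hw0
    rw [Finset.prod_insert hpP, Finset.prod_insert hpP, mul_pow, ← hN] at *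
    have cop : ∀ {i d M : ℕ}, ¬ p ∣ M → d ∈ M.divisors → (p ^ i).Coprime d := fun {i d M} hM hd =>
      ((Nat.Prime.coprime_iff_not_dvd hp).mpr fun h =>
        hM (h.trans (Nat.dvd_of_mem_divisors hd))).pow_left i
    have fpow0 : ∀ i ≤ K, 0 ≤ f (p ^ i) := fun i hi =>
      hf0 _ ((pow_dvd_pow p hi).mul_right _)
    have ih' : ∀ c, 0 < c → ∑ l ∈ (N ^ K).divisors, L (c * l) * f l ≤
        (∏ p ∈ P, (1 + ε p)) * ∑ a ∈ N.divisors, L (c * a) * w a := fun c hc =>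
      ih (fun q hq => hP q (Finset.mem_insert_of_mem hq))
        (fun n hn => hf0 n (hn.mul_left _)) (fun n hn => hw0 n (hn.mul_left _))
        (fun q hq => hwf q (Finset.mem_insert_of_mem hq))
        (fun q hq => hε q (Finset.mem_insert_of_mem hq)) hc
    have hεp := hε p (Finset.mem_insert_self _ _)
    have hwfp := hwf p (Finset.mem_insert_self _ _)
    have hε0 : ∀ q ∈ P, 0 ≤ 1 + ε q := by
      intro q hq
      have h1 := hε q (Finset.mem_insert_of_mem hq)
      have h2 := hwf q (Finset.mem_insert_of_mem hq)
      have h3 : 0 ≤ ∑ k ∈ Finset.Ico 2 (K + 1), ((k : ℝ) + 1) * f (q ^ k) := by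
        refine Finset.sum_nonneg fun k hk => mul_nonneg (by positivity) (hf0 _ ?_)
        refine Dvd.dvd.mul_left ((pow_dvd_pow q (by simp at hk; omega : k ≤ K)).trans
          (pow_dvd_pow_of_dvd (Finset.dvd_prod_of_mem _ hq) K)) _
      linarith
    have hsplit : ∑ a ∈ (p * N).divisors, L (c * a) * w a =
        ∑ a ∈ N.divisors, w a * (L (c * a) + w p * L (c * (p * a))) := by
      have := sum_divisors_prime_pow_mul (K := 1) hp hpN (fun a => L (c * a) * w a)
      rw [pow_one] at this
      rw [this, Finset.sum_range_succ, Finset.sum_range_one, ← Finset.sum_add_distrib]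
      refine Finset.sum_congr rfl fun a ha => ?_
      have ha0 := Nat.pos_of_mem_divisors ha
      rw [pow_zero, one_mul, pow_one,
        hwmul p a hp.pos ha0 (by simpa using cop (i := 1) hpN ha)]
      ring
    have hlocal : ∀ a ∈ N.divisors, ∑ i ∈ Finset.range (K + 1), f (p ^ i) * L (c * (p ^ i * a)) ≤
        (1 + ε p) * (L (c * a) + w p * L (c * (p * a))) := by
      intro a ha
      have hca : 0 < c * a := Nat.mul_pos hc (Nat.pos_of_mem_divisors ha)
      have hLp : ∀ j : ℕ, L (c * (p ^ j * a)) ≤ (j + 1) * L (c * a) := fun j => by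
        rw [show c * (p ^ j * a) = p ^ j * (c * a) by ring]
        exact hL p _ j hp hca
      have hL1 := hLp 1
      rw [pow_one] at hL1
      have hwp : 0 ≤ w p := hw0 p (Dvd.intro _ rfl)
      have hs0 : 0 ≤ ∑ k ∈ Finset.Ico 2 (K + 1), ((k : ℝ) + 1) * f (p ^ k) :=
        Finset.sum_nonneg fun k hk => mul_nonneg (by positivity)
          (fpow0 k (by simp at hk; omega))
      have h2 : ∑ i ∈ Finset.Ico 2 (K + 1), f (p ^ i) * L (c * (p ^ i * a)) ≤
          (∑ k ∈ Finset.Ico 2 (K + 1), ((k : ℝ) + 1) * f (p ^ k)) * L (c * a) := by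
        rw [Finset.sum_mul]
        refine Finset.sum_le_sum fun k hk => ?_
        have := mul_le_mul_of_nonneg_left (hLp k) (fpow0 k (by simp at hk; omega))
        linarith
      rw [← Finset.sum_range_add_sum_Ico _ (by omega : 2 ≤ K + 1), Finset.sum_range_succ,
        Finset.sum_range_one, pow_zero, pow_one, one_mul, hf1]
      have hA := hL0 (c * a)
      have hB := hL0 (c * (p * a))
      push_cast at hL1
      have e1 : f p * L (c * (p * a)) ≤
          w p * L (c * (p * a)) + 2 * (f p - w p) * L (c * a) := by
        nlinarith [mul_le_mul_of_nonneg_left hL1 (sub_nonneg.mpr hwfp)]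
      have e2 := mul_le_mul_of_nonneg_right hεp hA
      have e3 : 0 ≤ ε p * (w p * L (c * (p * a))) :=
        mul_nonneg (by linarith) (mul_nonneg hwp hB)
      nlinarith
    calc ∑ l ∈ (p ^ K * N ^ K).divisors, L (c * l) * f l
        = ∑ i ∈ Finset.range (K + 1), f (p ^ i) *
            ∑ l ∈ (N ^ K).divisors, L (c * p ^ i * l) * f l := by
          rw [sum_divisors_prime_pow_mul hp hpNK]
          refine Finset.sum_congr rfl fun i _ => ?_
          rw [Finset.mul_sum]
          refine Finset.sum_congr rfl fun l hl => ?_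
          rw [hfmul _ _ (pow_pos hp.pos i) (Nat.pos_of_mem_divisors hl) (cop hpNK hl), mul_assoc c]
          ring
      _ ≤ ∑ i ∈ Finset.range (K + 1), f (p ^ i) *
            ((∏ p ∈ P, (1 + ε p)) * ∑ a ∈ N.divisors, L (c * p ^ i * a) * w a) := by
          refine Finset.sum_le_sum fun i hi => mul_le_mul_of_nonneg_left
            (ih' _ (Nat.mul_pos hc (pow_pos hp.pos i))) (fpow0 i (by simp at hi; omega))
      _ = (∏ p ∈ P, (1 + ε p)) * ∑ a ∈ N.divisors, w a *
            ∑ i ∈ Finset.range (K + 1), f (p ^ i) * L (c * (p ^ i * a)) := by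
          simp only [Finset.mul_sum]
          rw [Finset.sum_comm]
          refine Finset.sum_congr rfl fun a _ => Finset.sum_congr rfl fun i _ => ?_
          rw [mul_assoc c]
          ring
      _ ≤ (∏ p ∈ P, (1 + ε p)) * ∑ a ∈ N.divisors, w a *
            ((1 + ε p) * (L (c * a) + w p * L (c * (p * a)))) := by
          refine mul_le_mul_of_nonneg_left (Finset.sum_le_sum fun a ha =>
            mul_le_mul_of_nonneg_left (hlocal a ha)
              (hw0 a ((Nat.dvd_of_mem_divisors ha).mul_left _))) (Finset.prod_nonneg hε0)
      _ = _ := by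
          rw [hsplit, Finset.mul_sum, Finset.mul_sum]
          refine Finset.sum_congr rfl fun a _ => ?_
          ring

/-- The upper bound in Mertens' first theorem. -/
theorem sum_primesLE_log_div_le {n : ℕ} (hn : 0 < n) :
    ∑ p ∈ Nat.primesLE n, Real.log p / p ≤ Real.log n + Real.log 4 := by
  have hprime : ∀ p ∈ Nat.primesLE n, p.Prime := fun p hp => (Nat.mem_primesLE.mp hp).2
  have hdvd : ∏ p ∈ Nat.primesLE n, p ^ (n / p) ∣ n.factorial := by
    refine Finset.prod_dvd_of_isRelPrime ?_ ?_
    · intro p hp q hq hpq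
      have := (Nat.coprime_primes (hprime p hp) (hprime q hq)).mpr hpq
      exact Nat.coprime_iff_isRelPrime.mp (Nat.Coprime.pow _ _ this)
    · intro p hp
      rw [(hprime p hp).pow_dvd_factorial_iff (show Nat.log p n < Nat.log p n + 2 by omega)]
      calc n / p = n / p ^ 1 := by rw [pow_one]
        _ ≤ _ := Finset.single_le_sum (f := fun i => n / p ^ i) (fun _ _ => Nat.zero_le _)
            (by simp)
  have hle : ∏ p ∈ Nat.primesLE n, p ^ (n / p) ≤ n ^ n :=
    (Nat.le_of_dvd n.factorial_pos hdvd).trans n.factorial_le_pow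
  have hlog : ∑ p ∈ Nat.primesLE n, ((n / p : ℕ) : ℝ) * Real.log p ≤ n * Real.log n := by
    calc ∑ p ∈ Nat.primesLE n, ((n / p : ℕ) : ℝ) * Real.log p
        = Real.log ((∏ p ∈ Nat.primesLE n, p ^ (n / p) : ℕ) : ℝ) := by
          push_cast
          rw [Real.log_prod]
          · simp [Real.log_pow]
          · intro p hp
            exact pow_ne_zero _ (by exact_mod_cast (hprime p hp).ne_zero)
      _ ≤ Real.log ((n ^ n : ℕ) : ℝ) := by
          refine Real.log_le_log ?_ (by exact_mod_cast hle)
          exact_mod_cast Finset.prod_pos fun p hp => pow_pos (hprime p hp).pos _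
      _ = n * Real.log n := by push_cast; rw [Real.log_pow]
  have htheta : ∑ p ∈ Nat.primesLE n, Real.log p ≤ Real.log 4 * n := by
    rw [← Chebyshev.theta_eq_sum_primesLE_log]
    exact Chebyshev.theta_le_log4_mul_x n.cast_nonneg
  have hn' : (0 : ℝ) < n := by exact_mod_cast hn
  have key : n * ∑ p ∈ Nat.primesLE n, Real.log p / p ≤
      ∑ p ∈ Nat.primesLE n, ((n / p : ℕ) : ℝ) * Real.log p +
        ∑ p ∈ Nat.primesLE n, Real.log p := by
    rw [Finset.mul_sum, ← Finset.sum_add_distrib]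
    refine Finset.sum_le_sum fun p hp => ?_
    have hlogp : 0 ≤ Real.log p := Real.log_natCast_nonneg p
    have h1 : (n : ℝ) / p ≤ ((n / p : ℕ) : ℝ) + 1 := by
      rw [← Nat.floor_div_eq_div (K := ℝ)]
      exact (Nat.lt_floor_add_one _).le
    calc (n : ℝ) * (Real.log p / p) = n / p * Real.log p := by ring
      _ ≤ (((n / p : ℕ) : ℝ) + 1) * Real.log p := mul_le_mul_of_nonneg_right h1 hlogp
      _ = _ := by ring
  nlinarith

theorem sum_range_add_three_mul_half_pow_le (n : ℕ) :
    ∑ i ∈ Finset.range n, ((i : ℝ) + 3) * (1 / 2) ^ i ≤ 8 := by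
  have : ∑ i ∈ Finset.range n, ((i : ℝ) + 3) * (1 / 2) ^ i = 8 - (2 * n + 8) * (1 / 2) ^ n := by
    induction n with
    | zero => norm_num
    | succ n ih =>
      rw [Finset.sum_range_succ, ih, pow_succ]
      push_cast
      ring
  rw [this]
  have : (0 : ℝ) ≤ (2 * n + 8) * (1 / 2) ^ n := by positivity
  linarith

/-- The weight `ρ(n) / φ_F(n)`. -/
noncomputable def rhoDivPhi (F : Polynomial ℤ) (n : ℕ) : ℝ := polyRho F n / polyPhi F n

theorem rhoDivPhi_one (F : Polynomial ℤ) : rhoDivPhi F 1 = 1 := by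
  simp [rhoDivPhi, polyPhi, polyRho_one]

theorem polyPhi_mul (F : Polynomial ℤ) {m n : ℕ} (h : m.Coprime n) :
    polyPhi F (m * n) = polyPhi F m * polyPhi F n := by
  unfold polyPhi
  rw [h.primeFactors_mul, Finset.prod_union h.disjoint_primeFactors]
  push_cast
  ring

theorem rhoDivPhi_mul (F : Polynomial ℤ) {m n : ℕ} (hm : 0 < m) (hn : 0 < n)
    (h : m.Coprime n) : rhoDivPhi F (m * n) = rhoDivPhi F m * rhoDivPhi F n := by
  unfold rhoDivPhi
  rw [polyRho_mul F hm hn h, polyPhi_mul F h, Nat.cast_mul, mul_div_mul_comm]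

theorem polyPhi_pos (F : Polynomial ℤ) {n : ℕ} (hn : 0 < n)
    (h : ∀ p : ℕ, p.Prime → p ∣ n → polyRho F p < p) : 0 < polyPhi F n := by
  refine mul_pos (by exact_mod_cast hn) (Finset.prod_pos fun p hp => ?_)
  have hp' := Nat.prime_of_mem_primeFactors hp
  rw [sub_pos, div_lt_one (by exact_mod_cast hp'.pos)]
  exact_mod_cast h p hp' (Nat.dvd_of_mem_primeFactors hp)

/-- The primes beyond `D` are regular for `F`: few roots, each lifting in at most one way. -/
structure RegularBeyond (F : Polynomial ℤ) (D g : ℕ) : Prop where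
  six_le : 6 ≤ D
  two_mul_le : 2 * g ≤ D
  rho_le : ∀ p : ℕ, p.Prime → D < p → polyRho F p ≤ g
  rho_pow_le : ∀ p k : ℕ, p.Prime → D < p → 0 < k → polyRho F (p ^ k) ≤ polyRho F p

namespace RegularBeyond

variable {F : Polynomial ℤ} {D g : ℕ}

theorem rho_lt (h : RegularBeyond F D g) {p : ℕ} (hp : p.Prime) (hD : D < p) :
    polyRho F p < p := by
  have := h.rho_le p hp hD
  have := h.two_mul_le
  omega

theorem phi_pos (h : RegularBeyond F D g) {n : ℕ} (hn : 0 < n)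
    (hr : ∀ p : ℕ, p.Prime → p ∣ n → D < p) : 0 < polyPhi F n :=
  polyPhi_pos F hn fun p hp hpn => h.rho_lt hp (hr p hp hpn)

theorem rhoDivPhi_nonneg (h : RegularBeyond F D g) {n : ℕ} (hn : 0 < n)
    (hr : ∀ p : ℕ, p.Prime → p ∣ n → D < p) : 0 ≤ rhoDivPhi F n :=
  div_nonneg (Nat.cast_nonneg _) (h.phi_pos hn hr).le

theorem rhoDivPhi_prime_nonneg (h : RegularBeyond F D g) {p : ℕ} (hp : p.Prime) (hD : D < p) :
    0 ≤ rhoDivPhi F p :=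
  h.rhoDivPhi_nonneg hp.pos fun _ hq hqp => (Nat.prime_dvd_prime_iff_eq hq hp).mp hqp ▸ hD

theorem rhoDivPhi_prime_le (h : RegularBeyond F D g) {p : ℕ} (hp : p.Prime) (hD : D < p) :
    rhoDivPhi F p ≤ 2 * g / p := by
  have hp0 : (0 : ℝ) < p := by exact_mod_cast hp.pos
  have h1 : (polyRho F p : ℝ) ≤ g := by exact_mod_cast h.rho_le p hp hD
  have h2 : (2 : ℝ) * g ≤ p := by exact_mod_cast h.two_mul_le.trans hD.le
  have h3 : polyPhi F p = p - polyRho F p := by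
    rw [polyPhi, hp.primeFactors, Finset.prod_singleton]
    field_simp
  have h4 : (0 : ℝ) ≤ polyRho F p := Nat.cast_nonneg _
  have h5 : (polyRho F p : ℝ) < p := by exact_mod_cast h.rho_lt hp hD
  rw [rhoDivPhi, h3, div_le_div_iff₀ (by linarith) hp0]
  nlinarith

theorem rhoDivPhi_prime_pow_le (h : RegularBeyond F D g) {p k : ℕ} (hp : p.Prime) (hD : D < p)
    (hk : 0 < k) : rhoDivPhi F (p ^ k) ≤ rhoDivPhi F p * (p / p ^ k) := by
  have hp0 : (0 : ℝ) < p := by exact_mod_cast hp.pos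
  have h1 : (polyRho F (p ^ k) : ℝ) ≤ polyRho F p := by
    exact_mod_cast h.rho_pow_le p k hp hD hk
  have h5 : (polyRho F p : ℝ) < p := by exact_mod_cast h.rho_lt hp hD
  have hc : (0 : ℝ) < 1 - polyRho F p / p := by rw [sub_pos, div_lt_one hp0]; exact h5
  have e1 : rhoDivPhi F (p ^ k) = polyRho F (p ^ k) / (p ^ k * (1 - polyRho F p / p)) := by
    rw [rhoDivPhi, polyPhi, Nat.primeFactors_prime_pow hk.ne' hp, Finset.prod_singleton]
    push_cast
    rfl
  have e2 : rhoDivPhi F p * (p / p ^ k) = polyRho F p / (p ^ k * (1 - polyRho F p / p)) := by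
    rw [rhoDivPhi, polyPhi, hp.primeFactors, Finset.prod_singleton]
    field_simp
  rw [e1, e2]
  gcongr

end RegularBeyond

/-- The weight `n ^ α ρ(n) / φ_F(n)` used in Rankin's trick. -/
noncomputable def rankinWeight (F : Polynomial ℤ) (α : ℝ) (n : ℕ) : ℝ :=
  rhoDivPhi F n * (n : ℝ) ^ α

theorem rankinWeight_one (F : Polynomial ℤ) (α : ℝ) : rankinWeight F α 1 = 1 := by
  simp [rankinWeight, rhoDivPhi_one]

theorem rankinWeight_mul (F : Polynomial ℤ) (α : ℝ) {m n : ℕ} (hm : 0 < m) (hn : 0 < n)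
    (h : m.Coprime n) :
    rankinWeight F α (m * n) = rankinWeight F α m * rankinWeight F α n := by
  unfold rankinWeight
  rw [rhoDivPhi_mul F hm hn h, Nat.cast_mul, Real.mul_rpow m.cast_nonneg n.cast_nonneg]
  ring

theorem rpow_inv_log_le_three {p q : ℕ} (hp : 0 < p) (hpq : p ≤ q) (hq : 1 < q) :
    (p : ℝ) ^ (1 / Real.log q) ≤ 3 := by
  have hp0 : (0 : ℝ) < p := by exact_mod_cast hp
  have hlq : 0 < Real.log q := Real.log_pos (by exact_mod_cast hq)
  rw [Real.rpow_def_of_pos hp0]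
  refine (Real.exp_le_exp.mpr (?_ : _ ≤ (1 : ℝ))).trans Real.exp_one_lt_three.le
  rw [mul_one_div, div_le_one hlq]
  exact Real.log_le_log hp0 (by exact_mod_cast hpq)

namespace RegularBeyond

variable {F : Polynomial ℤ} {D g : ℕ}

theorem rankinWeight_nonneg (h : RegularBeyond F D g) (α : ℝ) {n : ℕ} (hn : 0 < n)
    (hr : ∀ p : ℕ, p.Prime → p ∣ n → D < p) : 0 ≤ rankinWeight F α n :=
  mul_nonneg (h.rhoDivPhi_nonneg hn hr) (by positivity)

theorem rankinWeight_prime_pow_nonneg (h : RegularBeyond F D g) (α : ℝ) {p : ℕ} (hp : p.Prime)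
    (hD : D < p) (k : ℕ) : 0 ≤ rankinWeight F α (p ^ k) :=
  h.rankinWeight_nonneg α (pow_pos hp.pos k) fun _ hq hqp =>
    (Nat.prime_dvd_prime_iff_eq hq hp).mp (hq.dvd_of_dvd_pow hqp) ▸ hD

theorem rankinWeight_prime_pow_succ_le (h : RegularBeyond F D g) {p q : ℕ} (hp : p.Prime)
    (hD : D < p) (hpq : p ≤ q) (i : ℕ) :
    rankinWeight F (1 / Real.log q) (p ^ (i + 1)) ≤ 3 * rhoDivPhi F p * (3 / p) ^ i := by
  have hp0 : (0 : ℝ) < p := by exact_mod_cast hp.pos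
  have h3 := rpow_inv_log_le_three hp.pos hpq (hp.one_lt.trans_le hpq)
  have hw := h.rhoDivPhi_prime_nonneg hp hD
  calc rankinWeight F (1 / Real.log q) (p ^ (i + 1))
      = rhoDivPhi F (p ^ (i + 1)) * ((p : ℝ) ^ (1 / Real.log q)) ^ (i + 1) := by
        rw [rankinWeight, Nat.cast_pow, ← Real.rpow_natCast, ← Real.rpow_mul hp0.le, mul_comm
          ((i + 1 : ℕ) : ℝ), Real.rpow_mul hp0.le, Real.rpow_natCast]
    _ ≤ rhoDivPhi F p * (p / p ^ (i + 1)) * 3 ^ (i + 1) := by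
        gcongr
        exact h.rhoDivPhi_prime_pow_le hp hD i.succ_pos
    _ = 3 * rhoDivPhi F p * (3 / p) ^ i := by
        rw [div_pow, pow_succ, pow_succ]
        field_simp

theorem three_div_pow_le (h : RegularBeyond F D g) {p : ℕ} (hD : D < p) (i : ℕ) :
    ((3 : ℝ) / p) ^ i ≤ (1 / 2) ^ i := by
  have : (6 : ℝ) ≤ p := by exact_mod_cast h.six_le.trans hD.le
  refine pow_le_pow_left₀ (by positivity) ?_ i
  rw [div_le_div_iff₀ (by linarith) (by norm_num)]
  linarith

theorem sum_rankinWeight_prime_pow_succ_le (h : RegularBeyond F D g) {q : ℕ} (hq : q.Prime)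
    (hD : D < q) (K : ℕ) :
    ∑ i ∈ Finset.range K, ((i : ℝ) + 1) * rankinWeight F (1 / Real.log q) (q ^ (i + 1)) ≤
      24 * rhoDivPhi F q := by
  have hw := h.rhoDivPhi_prime_nonneg hq hD
  calc _ ≤ ∑ i ∈ Finset.range K, 3 * rhoDivPhi F q * (((i : ℝ) + 3) * (1 / 2) ^ i) := by
        refine Finset.sum_le_sum fun i _ => ?_
        calc _ ≤ ((i : ℝ) + 3) * (3 * rhoDivPhi F q * (3 / q) ^ i) := by
              exact mul_le_mul (by linarith) (h.rankinWeight_prime_pow_succ_le hq hD le_rfl i)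
                (h.rankinWeight_prime_pow_nonneg _ hq hD _) (by positivity)
          _ ≤ ((i : ℝ) + 3) * (3 * rhoDivPhi F q * (1 / 2) ^ i) := by
              gcongr ((i : ℝ) + 3) * (3 * rhoDivPhi F q * ?_)
              exact h.three_div_pow_le hD i
          _ = _ := by ring
    _ ≤ 3 * rhoDivPhi F q * 8 := by
        rw [← Finset.mul_sum]
        exact mul_le_mul_of_nonneg_left (sum_range_add_three_mul_half_pow_le K) (by positivity)
    _ = _ := by ring

theorem rhoDivPhi_prime_le_rankinWeight (h : RegularBeyond F D g) {p : ℕ} (hp : p.Prime)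
    (hD : D < p) {α : ℝ} (hα : 0 ≤ α) : rhoDivPhi F p ≤ rankinWeight F α p :=
  le_mul_of_one_le_right (h.rhoDivPhi_prime_nonneg hp hD)
    (Real.one_le_rpow (by exact_mod_cast hp.one_le) hα)

theorem rankinWeight_local_le (h : RegularBeyond F D g) {p q : ℕ} (hp : p.Prime)
    (hD : D < p) (hpq : p ≤ q) (K : ℕ) :
    2 * (rankinWeight F (1 / Real.log q) p - rhoDivPhi F p) +
        ∑ k ∈ Finset.Ico 2 (K + 1), ((k : ℝ) + 1) * rankinWeight F (1 / Real.log q) (p ^ k) ≤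
      g * (8 * (Real.log p / p / Real.log q) + 144 * ((p : ℝ) ^ 2)⁻¹) := by
  have hp0 : (0 : ℝ) < p := by exact_mod_cast hp.pos
  have hlq : 0 < Real.log q := Real.log_pos (by exact_mod_cast hp.one_lt.trans_le hpq)
  have hlp : 0 ≤ Real.log p := Real.log_natCast_nonneg p
  have hw0 := h.rhoDivPhi_prime_nonneg hp hD
  have hw := h.rhoDivPhi_prime_le hp hD
  have hx1 : Real.log p / Real.log q ≤ 1 := by
    rw [div_le_one hlq]
    exact Real.log_le_log hp0 (by exact_mod_cast hpq)
  have hx0 : 0 ≤ Real.log p / Real.log q := by positivity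
  have hexp : (p : ℝ) ^ (1 / Real.log q) - 1 ≤ 2 * (Real.log p / Real.log q) := by
    rw [Real.rpow_def_of_pos hp0, mul_one_div]
    have := Real.abs_exp_sub_one_le (x := Real.log p / Real.log q) (by rwa [abs_of_nonneg hx0])
    rw [abs_of_nonneg hx0] at this
    exact (le_abs_self _).trans this
  have hfirst : 2 * (rankinWeight F (1 / Real.log q) p - rhoDivPhi F p) ≤
      g * (8 * (Real.log p / p / Real.log q)) :=
    calc 2 * (rankinWeight F (1 / Real.log q) p - rhoDivPhi F p)
        = 2 * rhoDivPhi F p * ((p : ℝ) ^ (1 / Real.log q) - 1) := by rw [rankinWeight]; ring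
      _ ≤ 2 * rhoDivPhi F p * (2 * (Real.log p / Real.log q)) := by gcongr
      _ ≤ 2 * (2 * g / p) * (2 * (Real.log p / Real.log q)) := by gcongr
      _ = _ := by ring
  have hsecond : ∑ k ∈ Finset.Ico 2 (K + 1),
      ((k : ℝ) + 1) * rankinWeight F (1 / Real.log q) (p ^ k) ≤ g * (144 * ((p : ℝ) ^ 2)⁻¹) := by
    rw [Finset.sum_Ico_eq_sum_range]
    calc _ ≤ ∑ i ∈ Finset.range (K + 1 - 2),
          g * (18 * ((p : ℝ) ^ 2)⁻¹) * (((i : ℝ) + 3) * (1 / 2) ^ i) := by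
          refine Finset.sum_le_sum fun i _ => ?_
          have e : ((2 + i : ℕ) : ℝ) + 1 = i + 3 := by push_cast; ring
          rw [e, show 2 + i = (i + 1) + 1 by ring]
          calc _ ≤ ((i : ℝ) + 3) * (3 * rhoDivPhi F p * (3 / p) ^ (i + 1)) := by
                gcongr
                exact h.rankinWeight_prime_pow_succ_le hp hD hpq (i + 1)
            _ = ((i : ℝ) + 3) * (3 * rhoDivPhi F p * ((3 / p) ^ i * (3 / p))) := by
                rw [pow_succ]
            _ ≤ ((i : ℝ) + 3) * (3 * (2 * g / p) * ((1 / 2) ^ i * (3 / p))) := by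
                gcongr ((i : ℝ) + 3) * (3 * ?_ * (?_ * (3 / p)))
                exact h.three_div_pow_le hD i
            _ = _ := by field_simp; ring
      _ ≤ g * (18 * ((p : ℝ) ^ 2)⁻¹) * 8 := by
          rw [← Finset.mul_sum]
          exact mul_le_mul_of_nonneg_left (sum_range_add_three_mul_half_pow_le _) (by positivity)
      _ = _ := by ring
  linarith

end RegularBeyond

/-- The primes in the open interval `(D, q)`. -/
def primesBetween (D q : ℕ) : Finset ℕ := (Finset.Ioo D q).filter Nat.Prime

theorem mem_primesBetween {D q p : ℕ} : p ∈ primesBetween D q ↔ (D < p ∧ p < q) ∧ p.Prime := by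
  simp [primesBetween]

theorem prod_one_add_local_le (D g : ℕ) {q : ℕ} (hq : 4 ≤ q) :
    ∏ p ∈ primesBetween D q,
        (1 + g * (8 * (Real.log p / p / Real.log q) + 144 * ((p : ℝ) ^ 2)⁻¹)) ≤
      Real.exp (304 * g) := by
  have hlq : 0 < Real.log q := Real.log_pos (by exact_mod_cast (by omega : 1 < q))
  have h4 : Real.log 4 ≤ Real.log q := Real.log_le_log (by norm_num) (by exact_mod_cast hq)
  have hlogp : ∀ p : ℕ, 0 ≤ Real.log p := fun p => Real.log_natCast_nonneg p
  have hterm : ∀ p : ℕ,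
      0 ≤ (g : ℝ) * (8 * (Real.log p / p / Real.log q) + 144 * ((p : ℝ) ^ 2)⁻¹) := by
    intro p
    have := hlogp p
    positivity
  have hsum1 : ∑ p ∈ primesBetween D q, Real.log p / p ≤ 2 * Real.log q := by
    have hsub : primesBetween D q ⊆ Nat.primesLE q := fun p hp => by
      rw [mem_primesBetween] at hp
      exact Nat.mem_primesLE.mpr ⟨hp.1.2.le, hp.2⟩
    have h1 := sum_primesLE_log_div_le (n := q) (by omega)
    have h2 := Finset.sum_le_sum_of_subset_of_nonneg (f := fun p : ℕ => Real.log p / p) hsub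
      fun p _ _ => div_nonneg (hlogp p) p.cast_nonneg
    linarith
  have hsum2 : ∑ p ∈ primesBetween D q, ((p : ℝ) ^ 2)⁻¹ ≤ 2 := by
    refine (Finset.sum_le_sum_of_subset_of_nonneg (Finset.filter_subset _ _)
      fun _ _ _ => by positivity).trans ((sum_Ioo_inv_sq_le (α := ℝ) D q).trans ?_)
    rw [div_le_iff₀ (by positivity)]
    have : (0 : ℝ) ≤ D := D.cast_nonneg
    linarith
  calc _ ≤ ∏ p ∈ primesBetween D q,
        Real.exp (g * (8 * (Real.log p / p / Real.log q) + 144 * ((p : ℝ) ^ 2)⁻¹)) := by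
        refine Finset.prod_le_prod (fun p _ => by linarith [hterm p]) fun p _ => ?_
        rw [add_comm]
        exact Real.add_one_le_exp _
    _ = Real.exp (g * (8 * ((∑ p ∈ primesBetween D q, Real.log p / p) / Real.log q) +
          144 * ∑ p ∈ primesBetween D q, ((p : ℝ) ^ 2)⁻¹)) := by
        rw [← Real.exp_sum, ← Finset.mul_sum, Finset.sum_add_distrib, ← Finset.mul_sum,
          ← Finset.mul_sum, Finset.sum_div]
    _ ≤ Real.exp (304 * g) := by
        rw [Real.exp_le_exp, mul_comm (304 : ℝ)]
        refine mul_le_mul_of_nonneg_left ?_ g.cast_nonneg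
        have : (∑ p ∈ primesBetween D q, Real.log p / p) / Real.log q ≤ 2 := by
          rwa [div_le_iff₀ hlq]
        linarith

theorem prime_mem_of_dvd_prod {P : Finset ℕ} (hP : ∀ p ∈ P, p.Prime) {p : ℕ} (hp : p.Prime)
    (h : p ∣ ∏ q ∈ P, q) : p ∈ P := by
  obtain ⟨q, hq, hpq⟩ := (Prime.dvd_finsetProd_iff hp.prime _).mp h
  exact (Nat.prime_dvd_prime_iff_eq hp (hP q hq)).mp hpq ▸ hq

theorem dvd_prod_pow_of_primeFactors_subset {n K : ℕ} (hn : 0 < n) (hnK : n ≤ K) {P : Finset ℕ}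
    (hP : n.primeFactors ⊆ P) : n ∣ (∏ p ∈ P, p) ^ K := by
  conv_lhs => rw [← Nat.prod_factorization_pow_eq_self hn.ne']
  rw [Finsupp.prod, Nat.support_factorization, ← Finset.prod_pow]
  refine (Finset.prod_dvd_prod_of_dvd _ (fun p => p ^ K) fun p _ => ?_).trans
    (Finset.prod_dvd_prod_of_subset _ _ _ hP)
  exact pow_dvd_pow _ ((Nat.factorization_lt p hn.ne').le.trans hnK)

theorem le_Pplus {n p : ℕ} (hn : 0 < n) (hp : p.Prime) (h : p ∣ n) : p ≤ Pplus n :=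
  Finset.le_sup (f := id) (hp.mem_primeFactors h hn.ne')

theorem Pplus_mem_primeFactors {n : ℕ} (hn : 1 < n) : Pplus n ∈ n.primeFactors := by
  obtain ⟨p, hp, h⟩ := Finset.exists_mem_eq_sup n.primeFactors
    (Nat.nonempty_primeFactors.mpr hn) id
  rw [Pplus, h]
  exact hp

theorem Pplus_eq_iff {n q : ℕ} (hn : 0 < n) (hq : q.Prime) :
    Pplus n = q ↔ q ∣ n ∧ ∀ p : ℕ, p.Prime → p ∣ n → p ≤ q := by
  constructor
  · rintro rfl
    have h1 : n ≠ 1 := by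
      rintro rfl
      simp [Pplus, Nat.not_prime_zero] at hq
    exact ⟨Nat.dvd_of_mem_primeFactors (Pplus_mem_primeFactors (by omega)),
      fun p hp h => le_Pplus hn hp h⟩
  · rintro ⟨h1, h2⟩
    exact le_antisymm (Finset.sup_le fun p hp => h2 p (Nat.prime_of_mem_primeFactors hp)
      (Nat.dvd_of_mem_primeFactors hp)) (le_Pplus hn hq h1)

/-- Rankin's trick applied to the integers with a given largest prime factor. -/
theorem RegularBeyond.sum_rankinWeight_le {F : Polynomial ℤ} {D g : ℕ}
    (h : RegularBeyond F D g) (η : ℝ) {q : ℕ} (hq : q.Prime) (hD : D < q) (s : Finset ℕ)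
    (hs : ∀ l ∈ s, 0 < l ∧ (∀ p : ℕ, p.Prime → p ∣ l → D < p) ∧ Pplus l = q) :
    ∑ l ∈ s, Lfun l η * rankinWeight F (1 / Real.log q) l ≤
      24 * Real.exp (304 * g) *
        ∑ a ∈ (∏ p ∈ primesBetween D q, p).divisors, Lfun (q * a) η * rhoDivPhi F (q * a) := by
  set α := 1 / Real.log q
  set P := primesBetween D q with hPdef
  have hP : ∀ p ∈ P, p.Prime := fun p hp => (mem_primesBetween.mp hp).2
  have hPD : ∀ p ∈ P, D < p := fun p hp => (mem_primesBetween.mp hp).1.1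
  have hPq : ∀ p ∈ P, p < q := fun p hp => (mem_primesBetween.mp hp).1.2
  set N := ∏ p ∈ P, p with hN
  have hN0 : 0 < N := Finset.prod_pos fun p hp => (hP p hp).pos
  have hqP : q ∉ P := fun hqP => (hPq q hqP).false
  have hqN : ¬ q ∣ N := fun hqN => hqP (prime_mem_of_dvd_prod hP hq hqN)
  set K := s.sup id + 1 with hK
  have hqNK : ¬ q ∣ N ^ K := fun h => hqN (hq.dvd_of_dvd_pow h)
  have hrough : ∀ n, n ∣ N ^ K → ∀ p : ℕ, p.Prime → p ∣ n → D < p := fun n hn p hp hpn =>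
    hPD p (prime_mem_of_dvd_prod hP hp (hp.dvd_of_dvd_pow (hpn.trans hn)))
  have hrough' : ∀ n, n ∣ N → ∀ p : ℕ, p.Prime → p ∣ n → D < p := fun n hn p hp hpn =>
    hPD p (prime_mem_of_dvd_prod hP hp (hpn.trans hn))
  have hpos : ∀ n, n ∣ N ^ K → 0 < n := fun n hn => Nat.pos_of_dvd_of_pos hn (pow_pos hN0 K)
  have hpos' : ∀ n, n ∣ N → 0 < n := fun n hn => Nat.pos_of_dvd_of_pos hn hN0
  have hα0 : 0 ≤ α := by
    have := Real.log_natCast_nonneg q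
    positivity
  have hLq0 : 0 ≤ rhoDivPhi F q := h.rhoDivPhi_prime_nonneg hq hD
  have hwN : ∀ a ∈ N.divisors, 0 ≤ rhoDivPhi F a := fun a ha =>
    h.rhoDivPhi_nonneg (Nat.pos_of_mem_divisors ha) (hrough' a (Nat.dvd_of_mem_divisors ha))
  have hfN : ∀ a ∈ (N ^ K).divisors, 0 ≤ rankinWeight F α a := fun a ha =>
    h.rankinWeight_nonneg α (Nat.pos_of_mem_divisors ha) (hrough a (Nat.dvd_of_mem_divisors ha))
  have hcop : ∀ {i d M : ℕ}, ¬ q ∣ M → d ∈ M.divisors → (q ^ i).Coprime d := fun {i d M} hM hd =>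
    ((Nat.Prime.coprime_iff_not_dvd hq).mpr fun h =>
      hM (h.trans (Nat.dvd_of_mem_divisors hd))).pow_left i
  have hcore : ∑ l ∈ (N ^ K).divisors, Lfun (q * l) η * rankinWeight F α l ≤
      Real.exp (304 * g) * ∑ a ∈ N.divisors, Lfun (q * a) η * rhoDivPhi F a := by
    refine (sum_divisors_prod_pow_le (f := rankinWeight F α) (w := rhoDivPhi F)
      (L := fun n => Lfun n η)
      (ε := fun p => g * (8 * (Real.log p / p / Real.log q) + 144 * ((p : ℝ) ^ 2)⁻¹))
      (by omega : 1 ≤ K) hP (rankinWeight_one F α) (rhoDivPhi_one F)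
      (fun n hn => h.rankinWeight_nonneg α (hpos n hn) (hrough n hn))
      (fun n hn => h.rhoDivPhi_nonneg (hpos' n hn) (hrough' n hn))
      (fun m n hm hn => rankinWeight_mul F α hm hn) (fun m n hm hn => rhoDivPhi_mul F hm hn)
      (fun n => Lfun_nonneg n η) (fun p m j hp hm => Lfun_prime_pow_mul_le hp hm j η)
      (fun p hp => h.rhoDivPhi_prime_le_rankinWeight (hP p hp) (hPD p hp) hα0)
      (fun p hp => h.rankinWeight_local_le (hP p hp) (hPD p hp) (hPq p hp).le K) hq.pos).trans ?_
    refine mul_le_mul_of_nonneg_right (prod_one_add_local_le D g ?_)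
      (Finset.sum_nonneg fun a ha => mul_nonneg (Lfun_nonneg _ _) (hwN a ha))
    have := h.six_le
    omega
  let G : ℕ → ℝ := fun d => if q ∣ d then Lfun d η * rankinWeight F α d else 0
  have hsub : s ⊆ (q ^ K * N ^ K).divisors := by
    intro l hl
    obtain ⟨hl0, hlD, hlq⟩ := hs l hl
    rw [Nat.mem_divisors]
    refine ⟨?_, mul_ne_zero (pow_pos hq.pos K).ne' (pow_pos hN0 K).ne'⟩
    have hlK : l ≤ K := (Finset.le_sup (f := id) hl).trans (Nat.le_succ _)
    rw [← mul_pow, hN, ← Finset.prod_insert (f := fun p => p) hqP]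
    refine dvd_prod_pow_of_primeFactors_subset hl0 hlK fun p hp => ?_
    have hp' := Nat.prime_of_mem_primeFactors hp
    have hpl := Nat.dvd_of_mem_primeFactors hp
    rw [Finset.mem_insert, hPdef, mem_primesBetween]
    rcases (((Pplus_eq_iff hl0 hq).mp hlq).2 p hp' hpl).eq_or_lt with e | e
    · exact Or.inl e
    · exact Or.inr ⟨⟨hlD p hp' hpl, e⟩, hp'⟩
  have hG0 : ∀ d ∈ (q ^ K * N ^ K).divisors, 0 ≤ G d := by
    intro d hd
    simp only [G]
    split_ifs
    · refine mul_nonneg (Lfun_nonneg _ _) (h.rankinWeight_nonneg α (Nat.pos_of_mem_divisors hd) ?_)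
      intro p hp hpd
      rcases (Nat.Prime.dvd_mul hp).mp (hpd.trans (Nat.dvd_of_mem_divisors hd)) with h1 | h1
      · exact (Nat.prime_dvd_prime_iff_eq hp hq).mp (hp.dvd_of_dvd_pow h1) ▸ hD
      · exact hrough _ dvd_rfl p hp h1
    · exact le_rfl
  calc ∑ l ∈ s, Lfun l η * rankinWeight F α l
      = ∑ l ∈ s, G l := Finset.sum_congr rfl fun l hl => by
        obtain ⟨hl0, -, hlq⟩ := hs l hl
        simp [G, ((Pplus_eq_iff hl0 hq).mp hlq).1]
    _ ≤ ∑ l ∈ (q ^ K * N ^ K).divisors, G l :=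
        Finset.sum_le_sum_of_subset_of_nonneg hsub fun d hd _ => hG0 d hd
    _ = ∑ i ∈ Finset.range K, ∑ d ∈ (N ^ K).divisors, G (q ^ (i + 1) * d) := by
        rw [sum_divisors_prime_pow_mul hq hqNK, Finset.sum_range_succ']
        have : ∑ d ∈ (N ^ K).divisors, G (q ^ 0 * d) = 0 := Finset.sum_eq_zero fun d hd => by
          have : ¬ q ∣ d := fun hqd => hqNK (hqd.trans (Nat.dvd_of_mem_divisors hd))
          simp [G, this]
        rw [this, add_zero]
    _ ≤ ∑ i ∈ Finset.range K, ((i : ℝ) + 1) * rankinWeight F α (q ^ (i + 1)) *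
          ∑ d ∈ (N ^ K).divisors, Lfun (q * d) η * rankinWeight F α d := by
        refine Finset.sum_le_sum fun i _ => ?_
        rw [Finset.mul_sum]
        refine Finset.sum_le_sum fun d hd => ?_
        have hd0 := Nat.pos_of_mem_divisors hd
        have hdvd : q ∣ q ^ (i + 1) * d := (dvd_pow_self q i.succ_ne_zero).mul_right d
        simp only [G, if_pos hdvd]
        rw [rankinWeight_mul F α (pow_pos hq.pos _) hd0 (hcop hqNK hd)]
        have hL := Lfun_prime_pow_mul_le hq (Nat.mul_pos hq.pos hd0) i η
        rw [← mul_assoc, ← pow_succ] at hL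
        calc _ ≤ ((i : ℝ) + 1) * Lfun (q * d) η *
              (rankinWeight F α (q ^ (i + 1)) * rankinWeight F α d) :=
              mul_le_mul_of_nonneg_right hL
                (mul_nonneg (h.rankinWeight_prime_pow_nonneg α hq hD _) (hfN d hd))
          _ = _ := by ring
    _ ≤ 24 * rhoDivPhi F q *
          (Real.exp (304 * g) * ∑ a ∈ N.divisors, Lfun (q * a) η * rhoDivPhi F a) := by
        rw [← Finset.sum_mul]
        exact mul_le_mul (h.sum_rankinWeight_prime_pow_succ_le hq hD K) hcore
          (Finset.sum_nonneg fun d hd => mul_nonneg (Lfun_nonneg _ _) (hfN d hd)) (by positivity)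
    _ = _ := by
        rw [Finset.mul_sum, Finset.mul_sum, Finset.mul_sum]
        refine Finset.sum_congr rfl fun a ha => ?_
        rw [rhoDivPhi_mul F hq.pos (Nat.pos_of_mem_divisors ha)
          (by simpa using hcop (i := 1) hqN ha)]
        ring

/-- Summing Rankin's bound over the largest prime factor. -/
theorem RegularBeyond.sum_rankinWeight_Pplus_le {F : Polynomial ℤ} {D g : ℕ}
    (h : RegularBeyond F D g) (η : ℝ) (M : ℕ) (s : Finset ℕ)
    (hs : ∀ l ∈ s, 0 < l ∧ (∀ p : ℕ, p.Prime → p ∣ l → D < p) ∧ Pplus l ≤ M) :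
    ∑ l ∈ s, Lfun l η * rankinWeight F (1 / Real.log (Pplus l)) l ≤
      24 * Real.exp (304 * g) *
        ∑ a ∈ (∏ p ∈ primesBetween D (M + 1), p).divisors, Lfun a η * rhoDivPhi F a := by
  set P := primesBetween D (M + 1) with hPdef
  have hP : ∀ p ∈ P, p.Prime := fun p hp => (mem_primesBetween.mp hp).2
  have hPD : ∀ p ∈ P, D < p := fun p hp => (mem_primesBetween.mp hp).1.1
  have hN0 : 0 < ∏ p ∈ P, p := Finset.prod_pos fun p hp => (hP p hp).pos
  have hroughA : ∀ a ∈ (∏ p ∈ P, p).divisors, ∀ p : ℕ, p.Prime → p ∣ a → p ∈ P :=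
    fun a ha p hp hpa => prime_mem_of_dvd_prod hP hp (hpa.trans (Nat.dvd_of_mem_divisors ha))
  have hmaps : ∀ n : ℕ, 0 < n → (∀ p : ℕ, p.Prime → p ∣ n → p ∈ P) → Pplus n ∈ insert 0 P := by
    intro n hn hnP
    rcases (Nat.succ_le_of_lt hn).eq_or_lt with e | e
    · simp [← e, Pplus]
    · have := Pplus_mem_primeFactors e
      exact Finset.mem_insert_of_mem
        (hnP _ (Nat.prime_of_mem_primeFactors this) (Nat.dvd_of_mem_primeFactors this))
  have hsP : ∀ l ∈ s, ∀ p : ℕ, p.Prime → p ∣ l → p ∈ P := fun l hl p hp hpl =>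
    mem_primesBetween.mpr ⟨⟨(hs l hl).2.1 p hp hpl,
      Nat.lt_succ_of_le ((le_Pplus (hs l hl).1 hp hpl).trans (hs l hl).2.2)⟩, hp⟩
  have hw0 : ∀ a ∈ (∏ p ∈ P, p).divisors, 0 ≤ Lfun a η * rhoDivPhi F a := fun a ha =>
    mul_nonneg (Lfun_nonneg _ _) (h.rhoDivPhi_nonneg (Nat.pos_of_mem_divisors ha)
      fun p hp hpa => hPD p (hroughA a ha p hp hpa))
  rw [← Finset.sum_fiberwise_of_maps_to (fun l hl => hmaps l (hs l hl).1 (hsP l hl)),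
    ← Finset.sum_fiberwise_of_maps_to
      (fun a ha => hmaps a (Nat.pos_of_mem_divisors ha) (hroughA a ha)), Finset.mul_sum]
  refine Finset.sum_le_sum fun q hq => ?_
  rcases Finset.mem_insert.mp hq with rfl | hq
  · have hsub : s.filter (fun l => Pplus l = 0) ⊆ {1} := by
      intro l hl
      rw [Finset.mem_filter] at hl
      rw [Finset.mem_singleton]
      by_contra hl1
      have := Nat.prime_of_mem_primeFactors
        (Pplus_mem_primeFactors (n := l) (by have := (hs l hl.1).1; omega))
      rw [hl.2] at this
      exact Nat.not_prime_zero this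
    have hmem : 1 ∈ (∏ p ∈ P, p).divisors.filter (fun a => Pplus a = 0) := by
      rw [Finset.mem_filter, Nat.mem_divisors]
      exact ⟨⟨one_dvd _, hN0.ne'⟩, by simp [Pplus]⟩
    have hC : (1 : ℝ) ≤ 24 * Real.exp (304 * g) := by
      have : (1 : ℝ) ≤ Real.exp (304 * g) := Real.one_le_exp (by positivity)
      linarith
    have hL1 := Lfun_nonneg 1 η
    calc _ ≤ ∑ l ∈ {1}, Lfun l η * rankinWeight F (1 / Real.log (Pplus l)) l := by
          refine Finset.sum_le_sum_of_subset_of_nonneg hsub fun l hl _ => ?_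
          rw [Finset.mem_singleton.mp hl, rankinWeight_one, mul_one]
          exact hL1
      _ = Lfun 1 η * rhoDivPhi F 1 := by
          rw [Finset.sum_singleton, rankinWeight_one, rhoDivPhi_one]
      _ ≤ ∑ a ∈ (∏ p ∈ P, p).divisors.filter (fun a => Pplus a = 0), Lfun a η * rhoDivPhi F a :=
          Finset.single_le_sum (f := fun a => Lfun a η * rhoDivPhi F a)
            (fun a ha => hw0 a (Finset.mem_filter.mp ha).1) hmem
      _ ≤ _ := le_mul_of_one_le_left
            (Finset.sum_nonneg fun a ha => hw0 a (Finset.mem_filter.mp ha).1) hC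
  · have hqp := hP q hq
    calc _ = ∑ l ∈ s.filter (fun l => Pplus l = q),
            Lfun l η * rankinWeight F (1 / Real.log q) l :=
          Finset.sum_congr rfl fun l hl => by rw [(Finset.mem_filter.mp hl).2]
      _ ≤ 24 * Real.exp (304 * g) * ∑ a ∈ (∏ p ∈ primesBetween D q, p).divisors,
            Lfun (q * a) η * rhoDivPhi F (q * a) := by
          refine h.sum_rankinWeight_le η hqp (hPD q hq) _ fun l hl => ?_
          obtain ⟨hl, hlq⟩ := Finset.mem_filter.mp hl
          exact ⟨(hs l hl).1, (hs l hl).2.1, hlq⟩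
      _ ≤ _ := by
          refine mul_le_mul_of_nonneg_left ?_ (by positivity)
          rw [← Finset.sum_image (g := fun a => q * a)
            (f := fun a => Lfun a η * rhoDivPhi F a)
            fun a _ b _ hab => Nat.eq_of_mul_eq_mul_left hqp.pos hab]
          refine Finset.sum_le_sum_of_subset_of_nonneg ?_
            fun a ha _ => hw0 a (Finset.mem_filter.mp ha).1
          intro b hb
          obtain ⟨a, ha, rfl⟩ := Finset.mem_image.mp hb
          have hqlt : q < M + 1 := (mem_primesBetween.mp hq).1.2
          have hq_notMem : q ∉ primesBetween D q := fun hh => (mem_primesBetween.mp hh).1.2.false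
          have ha0 := Nat.pos_of_mem_divisors ha
          have hmax : ∀ p : ℕ, p.Prime → p ∣ a → p < q := fun p hp hpa =>
            (mem_primesBetween.mp (prime_mem_of_dvd_prod
              (fun p hp => (mem_primesBetween.mp hp).2) hp
              (hpa.trans (Nat.dvd_of_mem_divisors ha)))).1.2
          rw [Finset.mem_filter, Nat.mem_divisors, Pplus_eq_iff (Nat.mul_pos hqp.pos ha0) hqp]
          refine ⟨⟨?_, hN0.ne'⟩, Dvd.intro _ rfl, fun p hp hpa => ?_⟩
          · refine (mul_dvd_mul_left q (Nat.dvd_of_mem_divisors ha)).trans ?_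
            rw [← Finset.prod_insert (f := fun p => p) hq_notMem]
            refine Finset.prod_dvd_prod_of_subset _ _ _ (Finset.insert_subset hq fun p hp => ?_)
            rw [mem_primesBetween] at hp
            exact mem_primesBetween.mpr ⟨⟨hp.1.1, hp.1.2.trans hqlt⟩, hp.2⟩
          · rcases (Nat.Prime.dvd_mul hp).mp hpa with h1 | h1
            · exact Nat.le_of_dvd hqp.pos h1
            · exact (hmax p hp h1).le

/-- The squarefree integers composed of primes in `(D, z]` are the divisors of one integer. -/
theorem Psf_eq_divisors (D : ℕ) {z : ℝ} (hz : 0 ≤ z) :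
    Psf D z = ((∏ p ∈ primesBetween D (⌊z⌋₊ + 1), p).divisors : Set ℕ) := by
  set P := primesBetween D (⌊z⌋₊ + 1) with hPdef
  have hP : ∀ p ∈ P, p.Prime := fun p hp => (mem_primesBetween.mp hp).2
  have hN0 : 0 < ∏ p ∈ P, p := Finset.prod_pos fun p hp => (hP p hp).pos
  have hmem : ∀ p : ℕ, p.Prime → (p ∈ P ↔ (D : ℝ) < p ∧ (p : ℝ) ≤ z) := by
    intro p hp
    rw [hPdef, mem_primesBetween, Nat.lt_succ_iff, Nat.le_floor_iff hz, Nat.cast_lt]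
    tauto
  ext a
  simp only [Psf, Set.mem_ofPred_eq, Finset.mem_coe, Nat.mem_divisors]
  constructor
  · rintro ⟨-, hsq, h⟩
    refine ⟨?_, hN0.ne'⟩
    rw [← Nat.prod_primeFactors_of_squarefree hsq]
    refine Finset.prod_dvd_prod_of_subset _ _ _ fun p hp => ?_
    have hp' := Nat.prime_of_mem_primeFactors hp
    exact (hmem p hp').mpr (h p hp' (Nat.dvd_of_mem_primeFactors hp))
  · rintro ⟨ha, -⟩
    have hsq : Squarefree (∏ p ∈ P, p) :=
      Finset.squarefree_prod_of_pairwise_isCoprime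
        (fun p hp q hq hpq => Nat.coprime_iff_isRelPrime.mp
          ((Nat.coprime_primes (hP p hp) (hP q hq)).mpr hpq))
        fun p hp => (hP p hp).prime.squarefree
    exact ⟨Nat.pos_of_dvd_of_pos ha hN0, hsq.squarefree_of_dvd ha, fun p hp hpa =>
      (hmem p hp).mp (prime_mem_of_dvd_prod hP hp (hpa.trans ha))⟩

theorem inv_sq_log_le {q l z : ℝ} (hq : 1 < q) (hql : q ≤ l) (hz : 1 < z) :
    1 / (Real.log (q + z ^ ((3 : ℝ) / 4) / l)) ^ 2 ≤
      32 / (Real.log z) ^ 2 * l ^ (1 / Real.log q) := by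
  have hl0 : 0 < l := by linarith
  have hz0 : 0 < z := by linarith
  have hlz : 0 < Real.log z := Real.log_pos hz
  have hlq : 0 < Real.log q := Real.log_pos hq
  have hzpow : 0 < z ^ ((3 : ℝ) / 4) := Real.rpow_pos_of_pos hz0 _
  set A := q + z ^ ((3 : ℝ) / 4) / l with hA
  have hqA : q ≤ A := le_add_of_nonneg_right (by positivity)
  have hlqA : Real.log q ≤ Real.log A := Real.log_le_log (by linarith) hqA
  have hlA : 0 < Real.log A := hlq.trans_le hlqA
  set u := Real.log l / Real.log q with hu
  have hu1 : 1 ≤ u := by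
    rw [hu, le_div_iff₀ hlq, one_mul]
    exact Real.log_le_log (by linarith) hql
  have hulq : u * Real.log q = Real.log l := by rw [hu]; field_simp
  have hlin : Real.log z ≤ 4 * (u * Real.log A) := by
    rcases le_total (Real.log l) (Real.log z / 2) with hc | hc
    · have h1 : Real.log z / 4 ≤ Real.log A := by
        have h2 : Real.log (z ^ ((3 : ℝ) / 4) / l) ≤ Real.log A :=
          Real.log_le_log (by positivity) (le_add_of_nonneg_left (by linarith))
        rw [Real.log_div hzpow.ne' hl0.ne', Real.log_rpow hz0] at h2
        linarith
      nlinarith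
    · nlinarith [mul_le_mul_of_nonneg_left hlqA (by linarith : 0 ≤ u)]
  have hsq : (Real.log z) ^ 2 ≤ 16 * u ^ 2 * (Real.log A) ^ 2 := by
    calc (Real.log z) ^ 2 ≤ (4 * (u * Real.log A)) ^ 2 := by gcongr
      _ = _ := by ring
  have hexp : u ^ 2 ≤ 2 * l ^ (1 / Real.log q) := by
    rw [Real.rpow_def_of_pos hl0, mul_one_div, ← hu]
    have := Real.quadratic_le_exp_of_nonneg (by linarith : 0 ≤ u)
    linarith
  have hA2 : 0 < (Real.log A) ^ 2 := by positivity
  rw [div_mul_eq_mul_div, div_le_div_iff₀ hA2 (by positivity)]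
  nlinarith [mul_le_mul_of_nonneg_right hexp hA2.le]

/-- Every irreducible polynomial of positive degree is regular beyond some bound. -/
theorem exists_regularBeyond (F : Polynomial ℤ) (hF : Irreducible F) (hdeg : F.natDegree ≠ 0) :
    ∃ D, RegularBeyond F D F.natDegree := by
  obtain ⟨A, B, R, hR0, hR⟩ := exists_bezout_derivative F hF hdeg
  have hnd : ∀ (c : ℤ) (p : ℕ), c ≠ 0 → c.natAbs < p → ¬ (p : ℤ) ∣ c := fun c p hc hlt hdvd =>
    (Nat.le_of_dvd (Int.natAbs_pos.mpr hc) (Int.natCast_dvd.mp hdvd)).not_gt hlt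
  refine ⟨6 + 2 * F.natDegree + F.leadingCoeff.natAbs + R.natAbs, by omega, by omega, ?_, ?_⟩
  · intro p hp hD
    exact polyRho_prime_le_natDegree F hp
      (hnd _ p (Polynomial.leadingCoeff_ne_zero.mpr hF.ne_zero) (by omega))
  · intro p k hp hD hk
    exact polyRho_prime_pow_le F A B hR hp (hnd R p hR0 (by omega)) hk

theorem stmt15 (F : Polynomial ℤ) (hF : Irreducible F) (hdeg : 2 ≤ F.natDegree) :
    ∃ (D : ℕ) (K : ℝ), 2 ≤ D ∧ 0 < K ∧
      (∀ p : ℕ, p.Prime → D < p → polyRho F p < p) ∧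
      ∀ η z : ℝ, 0 < η → 100 ≤ z →
        ∑' ℓ : {ℓ : ℕ | 0 < ℓ ∧ (∀ p : ℕ, p.Prime → p ∣ ℓ → D < p) ∧ (Pplus ℓ : ℝ) ≤ z},
          Lfun ℓ η * (polyRho F ℓ : ℝ) /
            (polyPhi F ℓ * (Real.log ((Pplus ℓ : ℝ) + z ^ ((3 : ℝ) / 4) / (ℓ : ℝ))) ^ 2) ≤
        K / (Real.log z) ^ 2 *
          ∑' a : (Psf D z), Lfun a η * (polyRho F a : ℝ) / polyPhi F a := by
  obtain ⟨D, h⟩ := exists_regularBeyond F hF (by omega)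
  refine ⟨D, 32 * (24 * Real.exp (304 * F.natDegree)), by linarith [h.six_le], by positivity,
    fun p hp hD => h.rho_lt hp hD, fun η z _ hz => ?_⟩
  have hz0 : 0 ≤ z := by linarith
  have hlz : 0 < Real.log z := Real.log_pos (by linarith)
  have hterm : ∀ l : ℕ, 0 < l → (∀ p : ℕ, p.Prime → p ∣ l → D < p) →
      Lfun l η * (polyRho F l : ℝ) /
        (polyPhi F l * (Real.log ((Pplus l : ℝ) + z ^ ((3 : ℝ) / 4) / (l : ℝ))) ^ 2) ≤
      32 / (Real.log z) ^ 2 * (Lfun l η * rankinWeight F (1 / Real.log (Pplus l)) l) := by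
    intro l hl hlD
    have hw := mul_nonneg (Lfun_nonneg l η) (h.rhoDivPhi_nonneg hl hlD)
    have hlog : 1 / (Real.log ((Pplus l : ℝ) + z ^ ((3 : ℝ) / 4) / (l : ℝ))) ^ 2 ≤
        32 / (Real.log z) ^ 2 * (l : ℝ) ^ (1 / Real.log (Pplus l)) := by
      rcases (Nat.succ_le_of_lt hl).eq_or_lt with e | e
      · obtain rfl : l = 1 := e.symm
        have : Pplus 1 = 0 := by simp [Pplus]
        rw [this, Nat.cast_one, Nat.cast_zero, Real.one_rpow, zero_add, div_one,
          Real.log_rpow (by linarith), mul_one, div_le_div_iff₀ (by positivity) (by positivity)]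
        nlinarith [sq_nonneg (Real.log z)]
      · have hmem := Pplus_mem_primeFactors e
        exact inv_sq_log_le (by exact_mod_cast (Nat.prime_of_mem_primeFactors hmem).one_lt)
          (by exact_mod_cast Nat.le_of_dvd hl (Nat.dvd_of_mem_primeFactors hmem)) (by linarith)
    calc _ = Lfun l η * rhoDivPhi F l *
          (1 / (Real.log ((Pplus l : ℝ) + z ^ ((3 : ℝ) / 4) / (l : ℝ))) ^ 2) := by
          rw [rhoDivPhi, mul_one_div, mul_div_assoc', div_div]
      _ ≤ _ := mul_le_mul_of_nonneg_left hlog hw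
      _ = _ := by rw [rankinWeight]; ring
  have hrhs : ∑' a : (Psf D z), Lfun a η * (polyRho F a : ℝ) / polyPhi F a =
      ∑ a ∈ (∏ p ∈ primesBetween D (⌊z⌋₊ + 1), p).divisors, Lfun a η * rhoDivPhi F a := by
    rw [Psf_eq_divisors D hz0, Finset.tsum_subtype' _
      fun a : ℕ => Lfun a η * (polyRho F a : ℝ) / polyPhi F a]
    exact Finset.sum_congr rfl fun a _ => mul_div_assoc _ _ _
  rw [hrhs]
  refine Real.tsum_le_of_sum_le (fun l => ?_) fun s => ?_
  · exact div_nonneg (mul_nonneg (Lfun_nonneg _ _) (Nat.cast_nonneg _))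
      (mul_nonneg (h.phi_pos l.2.1 l.2.2.1).le (sq_nonneg _))
  · calc _ ≤ ∑ l ∈ s, 32 / (Real.log z) ^ 2 *
          (Lfun l η * rankinWeight F (1 / Real.log (Pplus l)) l) :=
          Finset.sum_le_sum fun l _ => hterm l l.2.1 l.2.2.1
      _ = 32 / (Real.log z) ^ 2 * ∑ l ∈ s.map (Function.Embedding.subtype _),
          Lfun l η * rankinWeight F (1 / Real.log (Pplus l)) l := by
          rw [← Finset.mul_sum, Finset.sum_map]
          rfl
      _ ≤ 32 / (Real.log z) ^ 2 * (24 * Real.exp (304 * F.natDegree) *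
          ∑ a ∈ (∏ p ∈ primesBetween D (⌊z⌋₊ + 1), p).divisors, Lfun a η * rhoDivPhi F a) := by
          refine mul_le_mul_of_nonneg_left
            (h.sum_rankinWeight_Pplus_le η ⌊z⌋₊ _ fun l hl => ?_) (by positivity)
          obtain ⟨l, -, rfl⟩ := Finset.mem_map.mp hl
          exact ⟨l.2.1, l.2.2.1, Nat.le_floor l.2.2.2⟩
      _ = _ := by ring
end

section
/- Let F ∈ ℤ[t] be an irreducible polynomial of degree g ≥ 2. There exist constants D ≥ 2, z₀ and K > 0, depending only on F, such that for all reals z ≥ z₀, all reals η with 0 < η ≤ log z, and all integers k with 0 ≤ k ≤ 10v, where v = ⌈log log z / log 2⌉: ∑_{a ∈ 𝒫(D, z), ω(a) = k} L(a; η) ρ(a)/φ_F(a) ≤ K · (η + 1) · (2v log 2)^k · U_k(v; min(1, η)), where ω(a) is the number of distinct prime factors of a and U_k(v; t) = ∫_{0 ≤ ξ₁ ≤ ⋯ ≤ ξ_k ≤ 1} min_{0 ≤ j ≤ k} 2^{−j}(2^{vξ₁} + ⋯ + 2^{vξ_j} + t) dξ₁⋯dξ_k (with the convention that the empty sum 2^{vξ₁}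 + ⋯ + 2^{vξ_j} is 0 when j = 0). -/
open Real MeasureTheory
open scoped Classical

/-- U_k(v;t) = ∫_{0 ≤ ξ₁ ≤ ⋯ ≤ ξ_k ≤ 1} min_{0 ≤ j ≤ k} 2^{-j}(2^{vξ₁}+⋯+2^{vξ_j}+t) dξ -/
noncomputable def Uk (k : ℕ) (v t : ℝ) : ℝ :=
  ∫ ξ in {ξ : Fin k → ℝ | (∀ i j : Fin k, i ≤ j → ξ i ≤ ξ j) ∧ ∀ i, 0 ≤ ξ i ∧ ξ i ≤ 1},
    (Finset.range (k + 1)).inf' ⟨0, Finset.mem_range.mpr (Nat.succ_pos k)⟩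
      (fun j => ((2 : ℝ) ^ j)⁻¹ *
        ((∑ i : Fin k, if (i : ℕ) < j then (2 : ℝ) ^ (v * ξ i) else 0) + t))

namespace NumberField

open _root_.Ideal

variable (K : Type*) [Field K] [NumberField K]

/-- The number of ideals of absolute norm `n` in the ring of integers of `K`. -/
noncomputable def idealCount (n : ℕ) : ℕ := Nat.card {I : Ideal (𝓞 K) // absNorm I = n}

theorem idealCount_one : idealCount K 1 = 1 := by
  simp [idealCount, absNorm_eq_one_iff]

theorem idealCount_mul_of_coprime {m n : ℕ} (h : m.Coprime n) :
    idealCount K (m * n) = idealCount K m * idealCount K n := by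
  have key : ∀ a b : ℕ, a.Coprime b → ∀ I J : Ideal (𝓞 K), absNorm I = a → absNorm J = b →
      I * J ⊔ span {(a : 𝓞 K)} = I := by
    intro a b hab I J hI hJ
    have ha : (a : 𝓞 K) ∈ I := by rw [← hI]; exact absNorm_mem I
    have hb : (b : 𝓞 K) ∈ J := by rw [← hJ]; exact absNorm_mem J
    apply le_antisymm
    · exact sup_le Ideal.mul_le_left (by rwa [span_singleton_le_iff_mem])
    · intro x hx
      obtain ⟨u, v, huv⟩ := (Nat.isCoprime_iff_coprime.mpr hab)
      have h1 : (u : 𝓞 K) * a + v * b = 1 := by exact_mod_cast congrArg (Int.cast : ℤ → 𝓞 K) huv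
      have : x = x * (v * b) + (x * u) * a := by linear_combination -x * h1
      rw [this]
      refine Submodule.add_mem_sup (mul_mem_mul hx (J.mul_mem_left _ hb)) ?_
      exact Ideal.mul_mem_left _ _ (mem_span_singleton_self _)
  have key2 : ∀ a b : ℕ, a.Coprime b → ∀ I : Ideal (𝓞 K), absNorm I = a * b →
      (absNorm (I ⊔ span {(a : 𝓞 K)})).Coprime b := by
    intro a b hab I hI
    have : absNorm (I ⊔ span {(a : 𝓞 K)}) ∣ absNorm (span {(a : 𝓞 K)}) :=
      absNorm_dvd_absNorm_of_le le_sup_right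
    refine Nat.Coprime.coprime_dvd_left this ?_
    rw [absNorm_span_natCast]
    exact hab.pow_left _
  have key3 : ∀ I : Ideal (𝓞 K), absNorm I = m * n →
      (I ⊔ span {(m : 𝓞 K)}) * (I ⊔ span {(n : 𝓞 K)}) = I := by
    intro I hI
    have hmn : (m : 𝓞 K) * n ∈ I := by
      have := absNorm_mem I
      rw [hI] at this; exact_mod_cast this
    obtain ⟨u, v, huv⟩ := (Nat.isCoprime_iff_coprime.mpr h)
    have h1 : (u : 𝓞 K) * m + v * n = 1 := by exact_mod_cast congrArg (Int.cast : ℤ → 𝓞 K) huv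
    apply le_antisymm
    · rw [Ideal.sup_mul, Ideal.mul_sup (span _)]
      refine sup_le Ideal.mul_le_left (sup_le Ideal.mul_le_right ?_)
      rw [span_singleton_mul_span_singleton, span_singleton_le_iff_mem]
      exact hmn
    · intro x hx
      have : x = (u * m) * x + x * (v * n) := by linear_combination -x * h1
      rw [this]
      refine Ideal.add_mem _ (mul_mem_mul (Ideal.mul_mem_left _ _ ?_) ?_)
        (mul_mem_mul ?_ (Ideal.mul_mem_left _ _ ?_))
      · exact Ideal.mem_sup_right (mem_span_singleton_self _)
      · exact Ideal.mem_sup_left hx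
      · exact Ideal.mem_sup_left hx
      · exact Ideal.mem_sup_right (mem_span_singleton_self _)
  have key4 : ∀ I : Ideal (𝓞 K), absNorm I = m * n →
      absNorm (I ⊔ span {(m : 𝓞 K)}) = m ∧ absNorm (I ⊔ span {(n : 𝓞 K)}) = n := by
    intro I hI
    have h1 := key2 m n h I hI
    have h2 := key2 n m h.symm I (by rw [hI, mul_comm])
    have h3 : absNorm (I ⊔ span {(m : 𝓞 K)}) * absNorm (I ⊔ span {(n : 𝓞 K)}) = m * n := by
      rw [← map_mul, key3 I hI, hI]
    constructor
    · apply Nat.dvd_antisymm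
      · exact h1.dvd_of_dvd_mul_right (h3 ▸ Dvd.intro _ rfl)
      · exact h2.symm.dvd_of_dvd_mul_right (h3 ▸ Dvd.intro _ rfl)
    · apply Nat.dvd_antisymm
      · exact h2.dvd_of_dvd_mul_left (h3 ▸ Dvd.intro_left _ rfl)
      · exact h1.symm.dvd_of_dvd_mul_left (h3 ▸ Dvd.intro_left _ rfl)
  rw [idealCount, idealCount, idealCount, ← Nat.card_prod]
  refine Nat.card_congr ⟨fun I => (⟨_, (key4 I.1 I.2).1⟩, ⟨_, (key4 I.1 I.2).2⟩),
    fun P => ⟨P.1.1 * P.2.1, by rw [map_mul, P.1.2, P.2.2]⟩, ?_, ?_⟩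
  · intro I
    exact Subtype.ext (key3 I.1 I.2)
  · rintro ⟨⟨I, hI⟩, ⟨J, hJ⟩⟩
    refine Prod.ext (Subtype.ext (key m n h I J hI hJ)) (Subtype.ext ?_)
    change I * J ⊔ _ = J
    rw [mul_comm]
    exact key n m h.symm J I hJ hI

open UniqueFactorizationMonoid in
theorem idealCount_prime_pow_le {p : ℕ} (hp : p.Prime) (k : ℕ) :
    idealCount K (p ^ k) ≤ (k + 1) ^ Module.finrank ℤ (𝓞 K) := by
  classical
  have hprod : ∀ I : Ideal (𝓞 K), I ≠ 0 → (normalizedFactors I).prod = I := fun I hI => by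
    rw [prod_normalizedFactors_eq hI, normalize_eq]
  set T := (normalizedFactors (span {(p : 𝓞 K)})).toFinset with hT
  have hp0 : span {(p : 𝓞 K)} ≠ 0 := by
    simp [hp.ne_zero]
  have hdvd : ∀ P ∈ T, p ∣ absNorm P := by
    intro P hP
    rw [hT, Multiset.mem_toFinset] at hP
    have h1 : absNorm P ∣ p ^ Module.finrank ℤ (𝓞 K) := by
      rw [← absNorm_span_natCast]
      exact map_dvd _ (dvd_of_mem_normalizedFactors hP)
    obtain ⟨j, hj, hj'⟩ := (Nat.dvd_prime_pow hp).1 h1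
    have hne : absNorm P ≠ 1 := by
      rw [Ne, absNorm_eq_one_iff]
      exact (isPrime_of_prime (prime_of_normalized_factor _ hP)).ne_top
    rw [hj'] at hne ⊢
    exact dvd_pow_self _ (fun h => hne (by simp [h]))
  have hcard : T.card ≤ Module.finrank ℤ (𝓞 K) := by
    have h1 : (∏ P ∈ T, P) ∣ span {(p : 𝓞 K)} := by
      have : (∏ P ∈ T, P) = (normalizedFactors (span {(p : 𝓞 K)})).dedup.prod := by
        rw [Finset.prod_eq_multiset_prod, hT, Multiset.toFinset_val, Multiset.map_id']
      rw [this]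
      exact (Multiset.prod_dvd_prod_of_le (Multiset.dedup_le _)).trans (hprod _ hp0).dvd
    have h2 : p ^ T.card ∣ p ^ Module.finrank ℤ (𝓞 K) := by
      rw [← absNorm_span_natCast]
      refine dvd_trans ?_ (map_dvd absNorm h1)
      rw [map_prod, ← Finset.prod_const]
      exact Finset.prod_dvd_prod_of_dvd _ _ hdvd
    exact (Nat.pow_dvd_pow_iff_le_right hp.one_lt).1 h2
  have hne : ∀ I : {I : Ideal (𝓞 K) // absNorm I = p ^ k}, I.1 ≠ 0 := by
    rintro ⟨I, hI⟩ h
    simp only at h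
    rw [h] at hI
    simp only [map_zero] at hI
    exact (pow_ne_zero k hp.ne_zero) hI.symm
  have hmem : ∀ I : {I : Ideal (𝓞 K) // absNorm I = p ^ k}, ∀ Q ∈ normalizedFactors I.1, Q ∈ T := by
    rintro ⟨I, hI⟩ Q hQ
    have hQp := prime_of_normalized_factor _ hQ
    have h1 : I ∣ span {(p : 𝓞 K)} ^ k := by
      rw [Ideal.dvd_iff_le, span_singleton_pow, span_singleton_le_iff_mem]
      have := absNorm_mem I
      rw [hI] at this
      exact_mod_cast this
    have h2 : Q ∣ span {(p : 𝓞 K)} :=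
      hQp.dvd_of_dvd_pow ((dvd_of_mem_normalizedFactors hQ).trans h1)
    rw [hT, Multiset.mem_toFinset, mem_normalizedFactors_iff' hp0]
    exact ⟨hQp.irreducible, normalize_eq _, h2⟩
  have hcount : ∀ I : {I : Ideal (𝓞 K) // absNorm I = p ^ k}, ∀ P ∈ T,
      Multiset.count P (normalizedFactors I.1) < k + 1 := by
    rintro ⟨I, hI⟩ P hP
    have h0 := hne ⟨I, hI⟩
    simp only at h0 ⊢
    have h1 : P ^ Multiset.count P (normalizedFactors I) ∣ I := by
      rw [← Multiset.prod_replicate]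
      exact (Multiset.prod_dvd_prod_of_le (Multiset.le_count_iff_replicate_le.1 le_rfl)).trans
        (hprod _ h0).dvd
    have h2 : p ^ Multiset.count P (normalizedFactors I) ∣ p ^ k := by
      rw [← hI]
      refine dvd_trans (pow_dvd_pow_of_dvd (hdvd P hP) _) ?_
      rw [← map_pow]
      exact map_dvd _ h1
    exact Nat.lt_succ_of_le ((Nat.pow_dvd_pow_iff_le_right hp.one_lt).1 h2)
  let f : {I : Ideal (𝓞 K) // absNorm I = p ^ k} → (T → Fin (k + 1)) :=
    fun I P => ⟨Multiset.count P.1 (normalizedFactors I.1), hcount I P.1 P.2⟩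
  have hf : Function.Injective f := by
    intro I J hIJ
    have : normalizedFactors I.1 = normalizedFactors J.1 := by
      ext Q
      by_cases hQ : Q ∈ T
      · have := congrFun hIJ ⟨Q, hQ⟩
        simpa [f] using this
      · rw [Multiset.count_eq_zero.2 (fun h => hQ (hmem I Q h)),
          Multiset.count_eq_zero.2 (fun h => hQ (hmem J Q h))]
    apply Subtype.ext
    rw [← hprod _ (hne I), ← hprod _ (hne J), this]
  calc idealCount K (p ^ k) ≤ Nat.card (T → Fin (k + 1)) := Nat.card_le_card_of_injective f hf
    _ = (k + 1) ^ T.card := by simp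
    _ ≤ _ := Nat.pow_le_pow_right (by omega) hcard

open Filter Topology in
theorem exists_bounds_tsum_idealCount :
    ∃ c C : ℝ, 0 < c ∧ 0 < C ∧ ∀ᶠ s : ℝ in 𝓝[>] 1,
      Summable (fun n : ℕ => (idealCount K n : ℝ) * (n : ℝ) ^ (-s)) ∧
      c / (s - 1) ≤ ∑' n : ℕ, (idealCount K n : ℝ) * (n : ℝ) ^ (-s) ∧
      ∑' n : ℕ, (idealCount K n : ℝ) * (n : ℝ) ^ (-s) ≤ C / (s - 1) := by
  have hterm : ∀ s : ℝ, 1 < s → LSeries.term (fun n => (idealCount K n : ℂ)) (s : ℂ) =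
      fun n : ℕ => (((idealCount K n : ℝ) * (n : ℝ) ^ (-s) : ℝ) : ℂ) := by
    intro s hs
    funext n
    rcases eq_or_ne n 0 with rfl | hn
    · rw [LSeries.term_zero, Nat.cast_zero, Real.zero_rpow (by linarith)]
      simp
    · rw [LSeries.term_of_ne_zero hn, Complex.ofReal_mul, Complex.ofReal_cpow (by positivity)]
      push_cast
      rw [Complex.cpow_neg, div_eq_mul_inv]
  have hκ := dedekindZeta_residue_pos K
  have hlim := (tendsto_sub_one_mul_dedekindZeta_nhdsGT K).norm
  have hn : ‖((dedekindZeta_residue K : ℝ) : ℂ)‖ = dedekindZeta_residue K := by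
    rw [Complex.norm_real, Real.norm_of_nonneg hκ.le]
  rw [hn] at hlim
  refine ⟨dedekindZeta_residue K / 2, dedekindZeta_residue K * 2, by positivity, by positivity, ?_⟩
  filter_upwards [hlim.eventually (lt_mem_nhds (half_lt_self hκ)),
    hlim.eventually (gt_mem_nhds (show dedekindZeta_residue K < dedekindZeta_residue K * 2 by
      linarith)), self_mem_nhdsWithin] with s h1 h2 hs
  have hs : 1 < s := hs
  have hz : dedekindZeta K s = ∑' n, LSeries.term (fun n => (idealCount K n : ℂ)) (s : ℂ) n := rfl
  have hsum : Summable (fun n : ℕ => (idealCount K n : ℝ) * (n : ℝ) ^ (-s)) := by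
    by_contra hcon
    rw [hz, tsum_eq_zero_of_not_summable, mul_zero, norm_zero] at h1
    · linarith
    · rw [hterm s hs]
      intro h
      exact hcon (Complex.summable_ofReal.1 h)
  rw [hterm s hs, ← Complex.ofReal_tsum] at hz
  have h0 : 0 ≤ ∑' n : ℕ, (idealCount K n : ℝ) * (n : ℝ) ^ (-s) :=
    tsum_nonneg fun n => by positivity
  rw [norm_mul, hz, Complex.norm_real, Real.norm_of_nonneg h0] at h1 h2
  have h3 : ‖(s : ℂ) - 1‖ = s - 1 := by
    rw [← Complex.ofReal_one, ← Complex.ofReal_sub, Complex.norm_real,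
      Real.norm_of_nonneg (by linarith)]
  rw [h3] at h1 h2
  have h4 : 0 < s - 1 := by linarith
  refine ⟨hsum, ?_, ?_⟩
  · rw [div_le_iff₀ h4]; linarith
  · rw [le_div_iff₀ h4]; linarith

end NumberField

open Filter Topology in
/-- The prime sum attached to a nonnegative function, multiplicative on coprime arguments and of
polynomial growth along prime powers, agrees with the logarithm of its Dirichlet series up to a
uniformly bounded error. -/
theorem exists_abs_tsum_prime_sub_log_le (g : ℕ) : ∃ C : ℝ, ∀ (J : ℕ → ℕ) (s : ℝ), 1 < s →
    J 1 = 1 → (∀ m n : ℕ, m.Coprime n → J (m * n) = J m * J n) →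
    (∀ p k : ℕ, p.Prime → J (p ^ k) ≤ (k + 1) ^ g) →
    Summable (fun n : ℕ => (J n : ℝ) * (n : ℝ) ^ (-s)) →
    |∑' p : ℕ, (if p.Prime then (J p : ℝ) * (p : ℝ) ^ (-s) else 0) -
      Real.log (∑' n : ℕ, (J n : ℝ) * (n : ℝ) ^ (-s))| ≤ C := by
  have hB : Summable (fun e : ℕ => ((e : ℝ) + 3) ^ g * (1 / 2 : ℝ) ^ e) := by
    have h1 := summable_pow_mul_geometric_of_norm_lt_one (R := ℝ) g (r := 1 / 2)
      (by rw [Real.norm_of_nonneg] <;> norm_num)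
    have h2 := ((summable_nat_add_iff 3).2 h1).mul_left 8
    refine h2.congr fun e => ?_
    push_cast
    rw [pow_add]; ring
  set B : ℝ := ∑' e : ℕ, ((e : ℝ) + 3) ^ g * (1 / 2 : ℝ) ^ e with hBdef
  have hB0 : 0 ≤ B := tsum_nonneg fun e => by positivity
  have hsq : Summable (fun n : ℕ => 1 / (n : ℝ) ^ 2) :=
    Real.summable_one_div_nat_pow.2 (by norm_num)
  refine ⟨(B + 4 ^ g) * ∑' n : ℕ, 1 / (n : ℝ) ^ 2, ?_⟩
  intro J s hs hJ1 hJm hJp hsum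
  set f : ℕ → ℝ := fun n => (J n : ℝ) * (n : ℝ) ^ (-s) with hf
  have hfnn : ∀ n, 0 ≤ f n := fun n => by simp only [hf]; positivity
  have hf0 : f 0 = 0 := by
    simp only [hf]; rw [Nat.cast_zero (R := ℝ), Real.zero_rpow (by linarith), mul_zero]
  have hf1 : f 1 = 1 := by simp [hf, hJ1]
  have hfm : ∀ {m n : ℕ}, m.Coprime n → f (m * n) = f m * f n := by
    intro m n h
    simp only [hf]
    rw [hJm m n h, Nat.cast_mul, Nat.cast_mul, Real.mul_rpow (by positivity) (by positivity)]
    ring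
  have hnorm : Summable (‖f ·‖) := by
    refine hsum.congr fun n => ?_
    rw [Real.norm_of_nonneg (hfnn n)]
  have hE := EulerProduct.eulerProduct hf1 hfm hnorm hf0
  have hloc : ∀ p : ℕ, p.Prime →
      0 < ∑' e, f (p ^ e) ∧
      |f p - Real.log (∑' e, f (p ^ e))| ≤ (B + 4 ^ g) * (1 / (p : ℝ) ^ 2) := by
    intro p hp
    have hp2 : (2 : ℝ) ≤ p := by exact_mod_cast hp.two_le
    have hp0 : (0 : ℝ) < p := by linarith
    have hse : Summable (fun e => f (p ^ e)) :=
      hsum.comp_injective (Nat.pow_right_injective hp.two_le)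
    have hps : (p : ℝ) ^ (-s) ≤ 1 / p := by
      rw [one_div, ← Real.rpow_neg_one]
      exact Real.rpow_le_rpow_of_exponent_le (by linarith) (by linarith)
    have hps0 : 0 ≤ (p : ℝ) ^ (-s) := by positivity
    have hps2 : (p : ℝ) ^ (-s) ≤ 1 / 2 :=
      hps.trans (one_div_le_one_div_of_le (by norm_num) hp2)
    have hsplit : ∑' e, f (p ^ e) = 1 + f p + ∑' e, f (p ^ (e + 2)) := by
      rw [← hse.sum_add_tsum_nat_add 2]
      simp [Finset.sum_range_succ, hf1]
    have htail0 : 0 ≤ ∑' e, f (p ^ (e + 2)) := tsum_nonneg fun e => hfnn _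
    have htail : ∑' e, f (p ^ (e + 2)) ≤ B * (1 / (p : ℝ) ^ 2) := by
      rw [hBdef, ← tsum_mul_right]
      refine ((summable_nat_add_iff 2).2 hse).tsum_le_tsum ?_ (hB.mul_right _)
      intro e
      simp only [hf]
      have h1 : (J (p ^ (e + 2)) : ℝ) ≤ ((e : ℝ) + 3) ^ g := by
        have := hJp p (e + 2) hp
        have h : (J (p ^ (e + 2)) : ℝ) ≤ ((e + 2 + 1 : ℕ) : ℝ) ^ g := by exact_mod_cast this
        refine h.trans (le_of_eq ?_)
        push_cast; ring
      have h2 : ((p ^ (e + 2) : ℕ) : ℝ) ^ (-s) ≤ (1 / 2 : ℝ) ^ e * (1 / (p : ℝ) ^ 2) := by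
        rw [Nat.cast_pow, ← Real.rpow_natCast, ← Real.rpow_mul hp0.le, mul_comm,
          Real.rpow_mul hp0.le, Real.rpow_natCast, pow_add, ← one_div_pow]
        gcongr
      calc (J (p ^ (e + 2)) : ℝ) * ((p ^ (e + 2) : ℕ) : ℝ) ^ (-s)
          ≤ ((e : ℝ) + 3) ^ g * ((1 / 2 : ℝ) ^ e * (1 / (p : ℝ) ^ 2)) := by
            gcongr
        _ = _ := by ring
    have hx0 := hfnn p
    have hx : f p ≤ 2 ^ g * (1 / p) := by
      simp only [hf]
      have h1 : (J p : ℝ) ≤ 2 ^ g := by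
        have := hJp p 1 hp
        rw [pow_one] at this
        exact_mod_cast this
      gcongr
    have hx2 : f p ^ 2 ≤ 4 ^ g * (1 / (p : ℝ) ^ 2) := by
      calc f p ^ 2 ≤ (2 ^ g * (1 / (p : ℝ))) ^ 2 := by gcongr
        _ = _ := by rw [mul_pow, ← pow_mul, mul_comm g, pow_mul]; norm_num
    have hEpos : 0 < ∑' e, f (p ^ e) := by rw [hsplit]; linarith
    refine ⟨hEpos, ?_⟩
    have hup : Real.log (∑' e, f (p ^ e)) ≤ f p + B * (1 / (p : ℝ) ^ 2) := by
      have := Real.log_le_sub_one_of_pos hEpos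
      rw [hsplit] at this ⊢
      linarith
    have hlow : f p - f p ^ 2 ≤ Real.log (∑' e, f (p ^ e)) := by
      have h1 := Real.one_sub_inv_le_log_of_pos (show 0 < 1 + f p by linarith)
      have h2 : Real.log (1 + f p) ≤ Real.log (∑' e, f (p ^ e)) := by
        apply Real.log_le_log (by linarith)
        rw [hsplit]; linarith
      have h3 : f p - f p ^ 2 ≤ 1 - (1 + f p)⁻¹ := by
        have h4 : (1 + f p)⁻¹ * (1 + f p) = 1 := inv_mul_cancel₀ (by linarith)
        have h5 : (1 + f p)⁻¹ ≤ 1 - f p + f p ^ 2 := by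
          rw [inv_le_iff_one_le_mul₀ (by linarith)]
          nlinarith [pow_nonneg hx0 3]
        linarith
      linarith
    have h4g : (0 : ℝ) ≤ 4 ^ g * (1 / (p : ℝ) ^ 2) := by positivity
    have hBp : (0 : ℝ) ≤ B * (1 / (p : ℝ) ^ 2) := by positivity
    rw [abs_le, add_mul]
    constructor <;> linarith
  have hprimes : ∀ n : ℕ, ∑ p ∈ Finset.range n, (if p.Prime then f p else 0) =
      ∑ p ∈ Nat.primesBelow n, f p := by
    intro n
    rw [Nat.primesBelow, Finset.sum_filter]
  have hh : Summable (fun p : ℕ => if p.Prime then f p else 0) := by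
    refine Summable.of_nonneg_of_le (fun p => ?_) (fun p => ?_) hsum
    · split_ifs
      exacts [hfnn p, le_rfl]
    · split_ifs
      exacts [le_rfl, hfnn p]
  have hlim1 := hh.hasSum.tendsto_sum_nat
  have hpos : 0 < ∑' n, f n :=
    lt_of_lt_of_le (by rw [hf1]; norm_num) (hsum.le_tsum 1 fun n _ => hfnn n)
  have hlim2 := hE.log hpos.ne'
  refine le_of_tendsto (hlim1.sub hlim2).abs (Eventually.of_forall fun n => ?_)
  rw [hprimes, Real.log_prod (fun p hp => (hloc p (Nat.prime_of_mem_primesBelow hp)).1.ne'),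
    ← Finset.sum_sub_distrib]
  refine (Finset.abs_sum_le_sum_abs _ _).trans ?_
  refine (Finset.sum_le_sum fun p hp => (hloc p (Nat.prime_of_mem_primesBelow hp)).2).trans ?_
  rw [← Finset.mul_sum]
  refine mul_le_mul_of_nonneg_left ?_ (by positivity)
  exact hsq.sum_le_tsum _ fun n _ => by positivity

open Filter Topology in
theorem NumberField.exists_abs_tsum_prime_idealCount_sub_le (K : Type*) [Field K] [NumberField K] :
    ∃ C : ℝ, ∀ᶠ s : ℝ in 𝓝[>] 1,
      |∑' p : ℕ, (if p.Prime then (idealCount K p : ℝ) * (p : ℝ) ^ (-s) else 0) -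
        Real.log (1 / (s - 1))| ≤ C := by
  obtain ⟨C, hC⟩ := exists_abs_tsum_prime_sub_log_le (Module.finrank ℤ (NumberField.RingOfIntegers K))
  obtain ⟨c, c', hc, hc', h⟩ := exists_bounds_tsum_idealCount K
  refine ⟨C + |Real.log c| + |Real.log c'|, ?_⟩
  filter_upwards [h, self_mem_nhdsWithin] with s hs hs1
  have hs1 : 1 < s := hs1
  have h1 := hC (idealCount K) s hs1 (idealCount_one K) (fun m n => idealCount_mul_of_coprime K)
    (fun p k hp => idealCount_prime_pow_le K hp k) hs.1
  have h0 : 0 < 1 / (s - 1) := one_div_pos.2 (by linarith)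
  have e1 : c / (s - 1) = c * (1 / (s - 1)) := by ring
  have e2 : c' / (s - 1) = c' * (1 / (s - 1)) := by ring
  have h2 := Real.log_le_log (by positivity) (e1 ▸ hs.2.1)
  have h3 := Real.log_le_log (lt_of_lt_of_le (by positivity) (e1 ▸ hs.2.1)) (e2 ▸ hs.2.2)
  rw [Real.log_mul hc.ne' h0.ne'] at h2
  rw [Real.log_mul hc'.ne' h0.ne'] at h3
  have h4 := neg_abs_le (Real.log c)
  have h5 := le_abs_self (Real.log c')
  have h6 := abs_nonneg (Real.log c)
  have h7 := abs_nonneg (Real.log c')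
  rw [abs_le] at h1 ⊢
  constructor <;> linarith

section

open Ideal Polynomial NumberField
variable (K : Type*) [Field K] [NumberField K]

theorem exists_bijective_ringHom_idealsOfNorm {p : ℕ} [Fact p.Prime] :
    ∃ e : (𝓞 K →+* ZMod p) → {I : Ideal (𝓞 K) // absNorm I = p}, Function.Bijective e := by
  have hp : p.Prime := Fact.out
  have hker : ∀ φ : 𝓞 K →+* ZMod p, absNorm (RingHom.ker φ) = p := by
    intro φ
    rw [absNorm_apply, Submodule.cardQuot_apply]
    have e := RingHom.quotientKerEquivOfSurjective (ZMod.ringHom_surjective φ)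
    exact (Nat.card_congr e.toEquiv).trans (Nat.card_zmod p)
  refine ⟨fun φ => ⟨RingHom.ker φ, hker φ⟩, ?_, ?_⟩
  · intro φ ψ h
    have h : RingHom.ker φ = RingHom.ker ψ := congrArg Subtype.val h
    ext x
    obtain ⟨n, hn⟩ := ZMod.intCast_surjective (φ x)
    have h1 : x - (n : 𝓞 K) ∈ RingHom.ker φ := by
      rw [RingHom.mem_ker, map_sub, map_intCast, hn, sub_self]
    rw [h, RingHom.mem_ker, map_sub, map_intCast, hn, sub_eq_zero] at h1
    exact h1.symm
  · rintro ⟨I, hI⟩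
    have hc : Nat.card (𝓞 K ⧸ I) = p := by
      rw [← hI, absNorm_apply, Submodule.cardQuot_apply]
    have : Finite (𝓞 K ⧸ I) := Nat.finite_of_card_ne_zero (hc ▸ hp.ne_zero)
    have := Fintype.ofFinite (𝓞 K ⧸ I)
    rw [Nat.card_eq_fintype_card] at hc
    let e := (ZMod.ringEquivOfPrime (𝓞 K ⧸ I) hp hc).symm
    refine ⟨(e : (𝓞 K ⧸ I) →+* ZMod p).comp (Ideal.Quotient.mk I), Subtype.ext ?_⟩
    ext x
    simp [RingHom.mem_ker, Ideal.Quotient.eq_zero_iff_mem]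

variable {K}

theorem exists_bijective_ringHom_roots {p : ℕ} [Fact p.Prime] {θ : 𝓞 K}
    (hpθ : ¬ p ∣ RingOfIntegers.exponent θ) :
    ∃ e : (𝓞 K →+* ZMod p) → {x : ZMod p // (minpoly ℤ θ).eval₂ (Int.castRingHom _) x = 0},
      Function.Bijective e := by
  have hroot : ∀ (φ : 𝓞 K →+* ZMod p) (Q : ℤ[X]),
      φ (aeval θ Q) = Q.eval₂ (Int.castRingHom _) (φ θ) := by
    intro φ Q
    rw [aeval_def, hom_eval₂]
    congr 1
    exact RingHom.ext_int _ _
  have hsurj := ZMod.ringHom_surjective (Int.castRingHom (ZMod p))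
  refine ⟨fun φ => ⟨φ θ, ?_⟩, ?_, ?_⟩
  · rw [← hroot, minpoly.aeval, map_zero]
  · intro φ ψ h
    have h : φ θ = ψ θ := congrArg Subtype.val h
    ext x
    let e := RingOfIntegers.ZModXQuotSpanEquivQuotSpan hpθ
    obtain ⟨q, hq⟩ := Ideal.Quotient.mk_surjective (e.symm (Ideal.Quotient.mk _ x))
    obtain ⟨Q, rfl⟩ := Polynomial.map_surjective _ hsurj q
    have h1 := RingOfIntegers.ZModXQuotSpanEquivQuotSpan_mk_apply hpθ Q
    have h2 : Ideal.Quotient.mk (span {(p : 𝓞 K)}) x =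
        Ideal.Quotient.mk (span {(p : 𝓞 K)}) (aeval θ Q) := by
      rw [← h1]; exact ((RingEquiv.symm_apply_eq e).1 hq.symm)
    rw [Ideal.Quotient.eq] at h2
    obtain ⟨y, hy⟩ := Ideal.mem_span_singleton.1 h2
    have h3 : ∀ χ : 𝓞 K →+* ZMod p, χ x = χ (aeval θ Q) := by
      intro χ
      rw [← sub_eq_zero, ← map_sub, hy, map_mul, map_natCast, CharP.cast_eq_zero, zero_mul]
    rw [h3 φ, h3 ψ, hroot, hroot, h]
  · rintro ⟨r, hr⟩
    let e := RingOfIntegers.ZModXQuotSpanEquivQuotSpan hpθ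
    let l : (ZMod p)[X] ⧸ span {map (Int.castRingHom (ZMod p)) (minpoly ℤ θ)} →+* ZMod p :=
      Ideal.Quotient.lift _ (evalRingHom r) (by
        intro a ha
        obtain ⟨b, rfl⟩ := mem_span_singleton.1 ha
        rw [map_mul, coe_evalRingHom, eval_map, hr, zero_mul])
    refine ⟨(l.comp e.symm.toRingHom).comp (Ideal.Quotient.mk _), Subtype.ext ?_⟩
    have h1 := RingOfIntegers.ZModXQuotSpanEquivQuotSpan_mk_apply hpθ X
    rw [aeval_X, map_X] at h1
    change l (e.symm (Ideal.Quotient.mk _ θ)) = r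
    rw [← h1, RingEquiv.symm_apply_apply]
    simp [l]

theorem idealCount_prime_eq_card_roots {p : ℕ} [Fact p.Prime] {θ : 𝓞 K}
    (hpθ : ¬ p ∣ RingOfIntegers.exponent θ) :
    idealCount K p =
      Nat.card {x : ZMod p // (minpoly ℤ θ).eval₂ (Int.castRingHom _) x = 0} := by
  obtain ⟨e, he⟩ := exists_bijective_ringHom_idealsOfNorm K (p := p)
  obtain ⟨e', he'⟩ := exists_bijective_ringHom_roots hpθ
  exact Nat.card_congr ((Equiv.ofBijective e he).symm.trans (Equiv.ofBijective e' he'))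

theorem exponent_ne_zero {θ : 𝓞 K} (h : Algebra.adjoin ℚ {algebraMap (𝓞 K) K θ} = ⊤) :
    RingOfIntegers.exponent θ ≠ 0 := by
  have hInt : IsIntegral ℤ θ := IsIntegralClosure.isIntegral ℤ K θ
  have h1 := conductor_mul_differentIdeal ℤ ℚ K θ h
  have h2 : aeval θ (derivative (minpoly ℤ θ)) ≠ 0 := by
    intro h0
    have hd := minpoly.isIntegrallyClosed_dvd hInt h0
    have hm := minpoly.monic hInt
    have hdeg := minpoly.natDegree_pos hInt
    have hne : derivative (minpoly ℤ θ) ≠ 0 := by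
      intro h
      have := derivative_eq_zero.1 h
      omega
    have := natDegree_le_of_dvd hd hne
    have := natDegree_derivative_lt hdeg.ne'
    omega
  have h3 : conductor ℤ θ ≠ ⊥ := by
    intro h0
    rw [h0, Ideal.bot_mul, eq_comm, span_singleton_eq_bot] at h1
    exact h2 h1
  rw [RingOfIntegers.exponent, Ne, absNorm_eq_zero_iff]
  intro h0
  exact h3 (Ideal.eq_bot_of_comap_eq_bot (R := ℤ) h0)

end

section

open Polynomial NumberField

theorem polyRho_eq_card_filter (F : ℤ[X]) (d : ℕ) :
    polyRho F d = ((Finset.range d).filter (fun n : ℕ => (d : ℤ) ∣ F.eval (n : ℤ))).card := by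
  rw [polyRho]
  symm
  refine Finset.card_bij (fun n _ => (n : ℤ)) ?_ ?_ ?_
  · intro n hn
    simpa using hn
  · intro a _ b _ h
    exact_mod_cast h
  · intro x hx
    simp only [Finset.mem_filter, Finset.bind_def, Finset.pure_def, Finset.mem_sup,
      Finset.mem_singleton, Finset.mem_range] at hx
    obtain ⟨⟨n, hn, rfl⟩, h⟩ := hx
    exact ⟨n, by simpa using ⟨hn, h⟩, rfl⟩

theorem polyRho_eq_card_roots (F : ℤ[X]) (p : ℕ) [Fact p.Prime] :
    polyRho F p = Nat.card {x : ZMod p // F.eval₂ (Int.castRingHom _) x = 0} := by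
  have hp : p.Prime := Fact.out
  have : NeZero p := ⟨hp.ne_zero⟩
  rw [polyRho_eq_card_filter, Nat.card_eq_fintype_card, Fintype.card_subtype]
  have hdvd : ∀ n : ℕ, (p : ℤ) ∣ F.eval (n : ℤ) ↔
      F.eval₂ (Int.castRingHom (ZMod p)) (n : ZMod p) = 0 := by
    intro n
    rw [← ZMod.intCast_zmod_eq_zero_iff_dvd, ← eval₂_id, ← eq_intCast (Int.castRingHom (ZMod p)),
      hom_eval₂]
    simp
  refine Finset.card_bij (fun n _ => (n : ZMod p)) ?_ ?_ ?_
  · intro n hn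
    rw [Finset.mem_filter] at hn ⊢
    exact ⟨Finset.mem_univ _, (hdvd n).1 hn.2⟩
  · intro a ha b hb h
    rw [Finset.mem_filter, Finset.mem_range] at ha hb
    rw [ZMod.natCast_eq_natCast_iff'] at h
    rwa [Nat.mod_eq_of_lt ha.1, Nat.mod_eq_of_lt hb.1] at h
  · intro x hx
    rw [Finset.mem_filter] at hx
    refine ⟨x.val, ?_, ZMod.natCast_zmod_val x⟩
    rw [Finset.mem_filter, Finset.mem_range, hdvd, ZMod.natCast_zmod_val]
    exact ⟨ZMod.val_lt x, hx.2⟩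

theorem polyRho_le_natDegree (F : ℤ[X]) {p : ℕ} (hp : p.Prime) (h : ¬ (p : ℤ) ∣ F.leadingCoeff) :
    polyRho F p ≤ F.natDegree := by
  have := Fact.mk hp
  have h0 : F.map (Int.castRingHom (ZMod p)) ≠ 0 := by
    intro h0
    have := congrArg (fun q => q.coeff F.natDegree) h0
    simp only [coeff_map, coeff_natDegree, coeff_zero, eq_intCast] at this
    exact h ((ZMod.intCast_zmod_eq_zero_iff_dvd _ _).1 this)
  rw [polyRho_eq_card_roots, Nat.card_eq_fintype_card, Fintype.card_subtype]
  calc _ ≤ (F.map (Int.castRingHom (ZMod p))).roots.toFinset.card := by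
        refine Finset.card_le_card fun x hx => ?_
        rw [Finset.mem_filter] at hx
        rw [Multiset.mem_toFinset, mem_roots h0, IsRoot, eval_map]
        exact hx.2
    _ ≤ (F.map (Int.castRingHom (ZMod p))).roots.card := Multiset.toFinset_card_le _
    _ ≤ _ := (card_roots' _).trans natDegree_map_le

theorem minpoly_leadingCoeff_mul_root {K : Type*} [Field K] [NumberField K] {F : ℤ[X]}
    (hdeg : 1 ≤ F.natDegree) {α : K} {θ : 𝓞 K}
    (hθ : algebraMap (𝓞 K) K θ = (F.leadingCoeff : K) * α) (hα : F.eval₂ (Int.castRingHom K) α = 0)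
    (hmin : ∀ q : ℚ[X], aeval α q = 0 → F.map (Int.castRingHom ℚ) ∣ q) :
    minpoly ℤ θ = integralNormalization F := by
  have hF0 : F ≠ 0 := by rintro rfl; simp at hdeg
  have ha0 : F.leadingCoeff ≠ 0 := leadingCoeff_ne_zero.2 hF0
  have hθint : IsIntegral ℤ θ := IsIntegralClosure.isIntegral ℤ K θ
  have hGθ : aeval θ (integralNormalization F) = 0 := by
    apply FaithfulSMul.algebraMap_injective (𝓞 K) K
    rw [map_zero, ← aeval_algebraMap_apply, hθ, aeval_def, algebraMap_int_eq]
    have := integralNormalization_eval₂_eq_zero (Int.castRingHom K) hα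
      (fun x hx => by simpa using hx)
    simpa using this
  have hdvd := minpoly.isIntegrallyClosed_dvd hθint hGθ
  refine (eq_of_monic_of_dvd_of_natDegree_le (minpoly.monic hθint)
    (monic_integralNormalization hF0) hdvd ?_).symm
  rw [natDegree_integralNormalization]
  rw [← natDegree_map_eq_of_injective (f := Int.castRingHom ℚ) Int.cast_injective F]
  set m := minpoly ℤ θ with hm
  have hmdeg : 0 < m.natDegree := minpoly.natDegree_pos hθint
  set q : ℚ[X] := (m.map (Int.castRingHom ℚ)).comp (C (F.leadingCoeff : ℚ) * X) with hq
  have hqdeg : q.natDegree = m.natDegree := by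
    rw [hq, natDegree_comp, natDegree_C_mul_X _ (by exact_mod_cast ha0), mul_one,
      natDegree_map_eq_of_injective Int.cast_injective]
  have hq0 : q ≠ 0 := by
    intro h
    rw [h, natDegree_zero] at hqdeg
    omega
  have hqα : aeval α q = 0 := by
    have h1 : aeval (algebraMap (𝓞 K) K θ) m = 0 := by
      rw [aeval_algebraMap_apply, minpoly.aeval, map_zero]
    rw [hq, aeval_comp, ← h1, hθ, map_mul, aeval_X, aeval_C, aeval_def, eval₂_map, aeval_def]
    congr 1
    · exact RingHom.ext_int _ _
    · rw [map_intCast]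
  rw [← hqdeg]
  exact natDegree_le_of_dvd (hmin q hqα) hq0

theorem exists_numberField_root {F : ℤ[X]} (hF : Irreducible F) (hdeg : 1 ≤ F.natDegree) :
    ∃ (K : Type) (_ : Field K) (_ : NumberField K) (α : K),
      F.eval₂ (Int.castRingHom K) α = 0 ∧ Algebra.adjoin ℚ {α} = ⊤ ∧
      ∀ q : ℚ[X], aeval α q = 0 → F.map (Int.castRingHom ℚ) ∣ q := by
  have hirr : Irreducible (F.map (Int.castRingHom ℚ)) :=
    (IsPrimitive.Int.irreducible_iff_irreducible_map_cast (hF.isPrimitive (by omega))).1 hF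
  have := Fact.mk hirr
  have hfin : FiniteDimensional ℚ (AdjoinRoot (F.map (Int.castRingHom ℚ))) :=
    (AdjoinRoot.powerBasis hirr.ne_zero).finite
  have hchar : CharZero (AdjoinRoot (F.map (Int.castRingHom ℚ))) :=
    charZero_of_injective_algebraMap
      (algebraMap ℚ (AdjoinRoot (F.map (Int.castRingHom ℚ)))).injective
  have hNF : NumberField (AdjoinRoot (F.map (Int.castRingHom ℚ))) :=
    { to_charZero := hchar, to_finiteDimensional := hfin }
  have halg : (DivisionRing.toRatAlgebra : Algebra ℚ (AdjoinRoot (F.map (Int.castRingHom ℚ)))) =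
      AdjoinRoot.instAlgebra _ := Subsingleton.elim _ _
  refine ⟨AdjoinRoot (F.map (Int.castRingHom ℚ)), inferInstance, hNF, AdjoinRoot.root _, ?_, ?_, ?_⟩
  · have := AdjoinRoot.eval₂_root (F.map (Int.castRingHom ℚ))
    rw [eval₂_map] at this
    rw [← this]
    congr 1
  · rw [halg]
    exact AdjoinRoot.adjoinRoot_eq_top
  · intro q hq
    rw [halg, AdjoinRoot.aeval_eq] at hq
    exact AdjoinRoot.mk_eq_zero.1 hq

/-- For an irreducible integer polynomial there is a number field whose degree one prime ideals
count, at all but finitely many primes, the roots of the polynomial modulo the prime. -/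
theorem exists_numberField_idealCount_eq_polyRho (F : ℤ[X]) (hF : Irreducible F)
    (hdeg : 1 ≤ F.natDegree) :
    ∃ (K : Type) (_ : Field K) (_ : NumberField K) (N : ℕ), N ≠ 0 ∧
      ∀ p : ℕ, p.Prime → ¬ p ∣ N →
        idealCount K p = polyRho F p ∧ polyRho F p ≤ F.natDegree := by
  obtain ⟨K, _, _, α, hα, hadj, hmin⟩ := exists_numberField_root hF hdeg
  have hF0 : F ≠ 0 := hF.ne_zero
  set a : ℤ := F.leadingCoeff with ha
  have ha0 : a ≠ 0 := leadingCoeff_ne_zero.2 hF0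
  have haK : (a : K) ≠ 0 := by exact_mod_cast ha0
  have hInt : IsIntegral ℤ ((a : K) * α) := by
    refine ⟨integralNormalization F, monic_integralNormalization hF0, ?_⟩
    rw [algebraMap_int_eq]
    have := integralNormalization_eval₂_eq_zero (Int.castRingHom K) hα
      (fun x hx => by simpa using hx)
    simpa using this
  obtain ⟨θ, hθ⟩ : ∃ θ : 𝓞 K, algebraMap (𝓞 K) K θ = (a : K) * α :=
    ⟨⟨(a : K) * α, hInt⟩, rfl⟩
  have hm := minpoly_leadingCoeff_mul_root hdeg hθ hα hmin
  have hadjθ : Algebra.adjoin ℚ {algebraMap (𝓞 K) K θ} = ⊤ := by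
    rw [eq_top_iff, ← hadj]
    refine Algebra.adjoin_le ?_
    rw [Set.singleton_subset_iff]
    have h1 : α = (a : ℚ)⁻¹ • algebraMap (𝓞 K) K θ := by
      rw [hθ, Algebra.smul_def, map_inv₀, map_intCast, ← mul_assoc, inv_mul_cancel₀ haK, one_mul]
    have h2 : algebraMap (𝓞 K) K θ ∈ Algebra.adjoin ℚ {algebraMap (𝓞 K) K θ} :=
      Algebra.subset_adjoin (Set.mem_singleton _)
    have h3 := Subalgebra.smul_mem _ h2 (a : ℚ)⁻¹
    rw [← h1] at h3
    exact h3
  refine ⟨K, _, ‹_›, RingOfIntegers.exponent θ * a.natAbs,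
    mul_ne_zero (exponent_ne_zero hadjθ) (by simpa using ha0), ?_⟩
  intro p hp hpN
  have := Fact.mk hp
  have hpe : ¬ p ∣ RingOfIntegers.exponent θ := fun h => hpN (h.mul_right _)
  have hpa : ¬ (p : ℤ) ∣ a := fun h => hpN ((Int.natCast_dvd.1 h).mul_left _)
  refine ⟨?_, polyRho_le_natDegree F hp hpa⟩
  rw [idealCount_prime_eq_card_roots hpe, hm, polyRho_eq_card_roots]
  have hap : ((a : ℤ) : ZMod p) ≠ 0 := fun h => hpa ((ZMod.intCast_zmod_eq_zero_iff_dvd _ _).1 h)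
  symm
  refine Nat.card_congr ((Equiv.mulLeft₀ (a : ZMod p) hap).subtypeEquiv fun x => ?_)
  have h := integralNormalization_eval₂_leadingCoeff_mul (p := F) (by omega)
    (Int.castRingHom (ZMod p)) x
  rw [eq_intCast] at h
  change _ ↔ eval₂ _ ((a : ZMod p) * x) _ = 0
  rw [h, mul_eq_zero, or_iff_right (pow_ne_zero _ hap)]

end

section

open Filter Topology

/-- If the Dirichlet series over the primes with bounded nonnegative coefficients `r p` equals
`log (1 / (s - 1))` up to a bounded error near `s = 1`, then the partial sums of `r p / p` equal
`log log n` up to a bounded error. -/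
theorem exists_abs_sum_prime_div_sub_log_log_le (r : ℕ → ℝ) (hr0 : ∀ p, 0 ≤ r p) {G : ℝ}
    (hrG : ∀ p : ℕ, p.Prime → r p ≤ G) {C : ℝ}
    (h : ∀ᶠ s : ℝ in 𝓝[>] 1,
      |∑' p : ℕ, (if p.Prime then r p * (p : ℝ) ^ (-s) else 0) - log (1 / (s - 1))| ≤ C) :
    ∃ C' : ℝ, ∀ᶠ n : ℕ in atTop,
      |∑ p ∈ (Finset.range (n + 1)).filter Nat.Prime, r p / p - log (log n)| ≤ C' := by
  have hlog : Tendsto (fun n : ℕ => log (n : ℝ)) atTop atTop :=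
    tendsto_log_atTop.comp tendsto_natCast_atTop_atTop
  have hlim : ∀ c : ℝ, 0 < c →
      Tendsto (fun n : ℕ => 1 + c / log (n : ℝ)) atTop (𝓝[>] 1) := by
    intro c hc
    refine tendsto_nhdsWithin_iff.2 ⟨?_, ?_⟩
    · simpa using (hlog.const_div_atTop c).const_add 1
    · filter_upwards [hlog.eventually_gt_atTop 0] with n hn
      have : 0 < c / log (n : ℝ) := by positivity
      simpa using this
  have hG : 0 ≤ G := (hr0 2).trans (hrG 2 Nat.prime_two)
  have hsum : ∀ s : ℝ, 1 < s →
      Summable fun p : ℕ => if p.Prime then r p * (p : ℝ) ^ (-s) else 0 := by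
    intro s hs
    refine Summable.of_nonneg_of_le (fun p => ?_) (fun p => ?_)
      ((Real.summable_nat_rpow.2 (show -s < -1 by linarith)).mul_left G)
    · have := hr0 p
      split_ifs <;> positivity
    · have : 0 ≤ (p : ℝ) ^ (-s) := by positivity
      split_ifs with hp
      · exact mul_le_mul_of_nonneg_right (hrG p hp) this
      · positivity
  refine ⟨C + 4 * (2 * C + log 2), ?_⟩
  filter_upwards [(hlim 1 one_pos).eventually h, (hlim (1 / 2) (by norm_num)).eventually h,
    hlog.eventually_gt_atTop 0] with n h1 h2 hL
  set L := log (n : ℝ) with hLdef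
  have e1 : 1 / (1 + 1 / L - 1) = L := by field_simp; ring
  have e2 : 1 / (1 + 1 / 2 / L - 1) = 2 * L := by field_simp; ring
  rw [e1] at h1
  rw [e2, log_mul (by norm_num) hL.ne'] at h2
  set a : ℕ → ℝ := fun p => if p.Prime then r p * (p : ℝ) ^ (-(1 + 1 / L)) else 0 with ha
  set b : ℕ → ℝ := fun p => if p.Prime then r p * (p : ℝ) ^ (-(1 + 1 / 2 / L)) else 0 with hb
  have hL1 : 0 < 1 / L := by positivity
  have hL2 : 0 < 1 / 2 / L := by positivity
  have hsa : Summable a := hsum _ (by linarith)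
  have hsb : Summable b := hsum _ (by linarith)
  set c : ℕ → ℝ := fun p => if p ∈ (Finset.range (n + 1)).filter Nat.Prime then r p / p else 0
    with hc
  have hcsum : HasSum c (∑ p ∈ (Finset.range (n + 1)).filter Nat.Prime, r p / p) := by
    have : ∑ p ∈ (Finset.range (n + 1)).filter Nat.Prime, r p / p =
        ∑ p ∈ (Finset.range (n + 1)).filter Nat.Prime, c p :=
      Finset.sum_congr rfl fun p hp => by rw [hc]; simp only [hp, if_true]
    rw [this]
    exact hasSum_sum_of_ne_finset_zero fun p hp => by rw [hc]; simp only [hp, if_false]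
  have key : ∀ p, |c p - a p| ≤ 4 * (b p - a p) := by
    intro p
    by_cases hp : p.Prime
    swap
    · simp [ha, hb, hc, hp]
    have hp0 : (0 : ℝ) < p := by exact_mod_cast hp.pos
    set t : ℝ := (p : ℝ) ^ (-(1 / 2 / L)) with ht
    have ht0 : 0 < t := by positivity
    have hte : t = exp (-(log p / L / 2)) := by
      rw [ht, Real.rpow_def_of_pos hp0]
      congr 1; ring
    have hbp : b p = r p / p * t := by
      simp only [hb, hp, if_true]
      rw [neg_add, Real.rpow_add hp0, Real.rpow_neg_one]; ring
    have hap : a p = r p / p * t ^ 2 := by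
      simp only [ha, hp, if_true]
      rw [neg_add, Real.rpow_add hp0, Real.rpow_neg_one, ht, ← Real.rpow_natCast,
        ← Real.rpow_mul hp0.le]
      have : -(1 / 2 / L) * ((2 : ℕ) : ℝ) = -(1 / L) := by push_cast; ring
      rw [this]; ring
    have hq : 0 ≤ r p / p := div_nonneg (hr0 p) hp0.le
    have hlogp : 0 ≤ log (p : ℝ) := log_nonneg (by exact_mod_cast hp.one_le)
    have hexp : exp (-(1 / 2 : ℝ)) ≤ 2 / 3 := by
      rw [exp_neg]
      have := add_one_le_exp (1 / 2 : ℝ)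
      rw [inv_le_comm₀ (exp_pos _) (by norm_num)]
      linarith
    have hexp' : 1 / 2 ≤ exp (-(1 / 2 : ℝ)) := by
      have := add_one_le_exp (-(1 / 2) : ℝ)
      linarith
    by_cases hpn : p ≤ n
    · have hcp : c p = r p / p := by
        simp only [hc, Finset.mem_filter, Finset.mem_range, hp, and_true]
        rw [if_pos (by omega)]
      have hu : log (p : ℝ) / L ≤ 1 := by
        rw [div_le_one hL]
        exact log_le_log hp0 (by exact_mod_cast hpn)
      have ht1 : t ≤ 1 := by
        rw [hte, exp_le_one_iff]
        have : 0 ≤ log (p : ℝ) / L := by positivity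
        linarith
      have ht2 : 1 / 2 ≤ t := hexp'.trans (by rw [hte, exp_le_exp]; linarith)
      rw [hcp, hap, hbp, show r p / p - r p / p * t ^ 2 = r p / p * (1 - t ^ 2) by ring,
        show 4 * (r p / p * t - r p / p * t ^ 2) = r p / p * (4 * (t - t ^ 2)) by ring,
        abs_of_nonneg (mul_nonneg hq (by nlinarith))]
      exact mul_le_mul_of_nonneg_left (by nlinarith) hq
    · have hcp : c p = 0 := by
        simp only [hc, Finset.mem_filter, Finset.mem_range, hp, and_true]
        rw [if_neg (by omega)]
      have hu : 1 ≤ log (p : ℝ) / L := by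
        rw [one_le_div hL]
        refine log_le_log ?_ (by exact_mod_cast (not_le.1 hpn).le)
        by_contra h0
        have h0 : (n : ℝ) = 0 := le_antisymm (not_lt.1 h0) (Nat.cast_nonneg n)
        rw [hLdef, h0, log_zero] at hL
        exact hL.false
      have ht2 : t ≤ 2 / 3 := le_trans (by rw [hte, exp_le_exp]; linarith) hexp
      rw [hcp, hap, hbp, zero_sub, abs_neg, abs_of_nonneg (by positivity),
        show 4 * (r p / p * t - r p / p * t ^ 2) = r p / p * (4 * (t - t ^ 2)) by ring]
      exact mul_le_mul_of_nonneg_left (by nlinarith) hq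
  have hca : |(∑ p ∈ (Finset.range (n + 1)).filter Nat.Prime, r p / p) - ∑' p, a p| ≤
      4 * (∑' p, b p - ∑' p, a p) := by
    rw [← hcsum.tsum_eq, ← hcsum.summable.tsum_sub hsa, ← hsb.tsum_sub hsa, ← tsum_mul_left]
    have hs4 : Summable fun p => 4 * (b p - a p) := (hsb.sub hsa).mul_left 4
    rw [abs_le, ← tsum_neg]
    constructor
    · exact hs4.neg.tsum_le_tsum (fun p => (abs_le.1 (key p)).1) (hcsum.summable.sub hsa)
    · exact (hcsum.summable.sub hsa).tsum_le_tsum (fun p => (abs_le.1 (key p)).2) hs4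
  rw [abs_le] at h1 h2 hca ⊢
  constructor <;> linarith

end

section

open Filter Topology NumberField

/-- The weight `ρ(p) / (p - ρ(p))` attached to a prime `p`. -/
noncomputable def rootWeight (F : Polynomial ℤ) (p : ℕ) : ℝ := polyRho F p / (p - polyRho F p)

theorem exists_abs_sum_rootWeight_sub_log_log_le (F : Polynomial ℤ) (hF : Irreducible F)
    (hdeg : 1 ≤ F.natDegree) :
    ∃ (D : ℕ) (C : ℝ), 2 ≤ D ∧ (∀ p : ℕ, p.Prime → D < p → 2 * polyRho F p ≤ p) ∧
      ∀ n : ℕ, |∑ p ∈ (Finset.Ioc D n).filter Nat.Prime, rootWeight F p - log (log n)| ≤ C := by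
  obtain ⟨K, _, _, N, hN, hρ⟩ := exists_numberField_idealCount_eq_polyRho F hF hdeg
  obtain ⟨C₀, hC₀⟩ := exists_abs_tsum_prime_idealCount_sub_le K
  have hJ : ∀ p : ℕ, p.Prime → (idealCount K p : ℝ) ≤ 2 ^ Module.finrank ℤ (𝓞 K) := by
    intro p hp
    have := idealCount_prime_pow_le K hp 1
    rw [pow_one] at this
    exact_mod_cast this
  obtain ⟨C₁, hC₁⟩ := exists_abs_sum_prime_div_sub_log_log_le (fun p => idealCount K p)
    (fun p => Nat.cast_nonneg _) hJ hC₀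
  set g := F.natDegree with hg
  set D := max (max N (2 * g)) 2 with hD
  have hDp : ∀ p : ℕ, p.Prime → D < p →
      idealCount K p = polyRho F p ∧ polyRho F p ≤ g ∧ 2 * g ≤ p := by
    intro p hp hDp
    have h1 : N < p := by omega
    obtain ⟨h2, h3⟩ := hρ p hp (fun h => by
      have := Nat.le_of_dvd (Nat.pos_of_ne_zero hN) h
      omega)
    exact ⟨h2, h3, by omega⟩
  set E : ℕ → ℝ := fun n =>
    ∑ p ∈ (Finset.Ioc D n).filter Nat.Prime, rootWeight F p - log (log n) with hE
  set A : ℝ := ∑ p ∈ (Finset.range (D + 1)).filter Nat.Prime, (idealCount K p : ℝ) / p with hA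
  have hsq : Summable (fun n : ℕ => 1 / (n : ℝ) ^ 2) :=
    Real.summable_one_div_nat_pow.2 (by norm_num)
  have hev : ∀ᶠ n : ℕ in atTop, |E n| ≤ C₁ + |A| + 2 * g ^ 2 * ∑' n : ℕ, 1 / (n : ℝ) ^ 2 := by
    filter_upwards [hC₁, eventually_ge_atTop D] with n hn hDn
    have hsplit : (Finset.range (n + 1)).filter Nat.Prime =
        (Finset.range (D + 1)).filter Nat.Prime ∪ (Finset.Ioc D n).filter Nat.Prime := by
      rw [← Finset.filter_union]
      congr 1
      ext m
      simp only [Finset.mem_range, Finset.mem_union, Finset.mem_Ioc]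
      omega
    have hdisj : Disjoint ((Finset.range (D + 1)).filter Nat.Prime)
        ((Finset.Ioc D n).filter Nat.Prime) := by
      rw [Finset.disjoint_left]
      intro m hm hm'
      simp only [Finset.mem_filter, Finset.mem_range, Finset.mem_Ioc] at hm hm'
      omega
    rw [hsplit, Finset.sum_union hdisj, ← hA] at hn
    have hbd : ∀ p ∈ (Finset.Ioc D n).filter Nat.Prime,
        0 ≤ rootWeight F p - (idealCount K p : ℝ) / p ∧
        rootWeight F p - (idealCount K p : ℝ) / p ≤ 2 * g ^ 2 * (1 / (p : ℝ) ^ 2) := by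
      intro p hp
      rw [Finset.mem_filter, Finset.mem_Ioc] at hp
      obtain ⟨h1, h2, h3⟩ := hDp p hp.2 hp.1.1
      have hp0 : (0 : ℝ) < p := by exact_mod_cast hp.2.pos
      have h2' : (polyRho F p : ℝ) ≤ g := by exact_mod_cast h2
      have h3' : 2 * (g : ℝ) ≤ p := by exact_mod_cast h3
      have hr0 : (0 : ℝ) ≤ polyRho F p := Nat.cast_nonneg _
      have hpr : 0 < (p : ℝ) - polyRho F p := by linarith
      rw [h1, rootWeight]
      have e : (polyRho F p : ℝ) / (p - polyRho F p) - polyRho F p / p =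
          polyRho F p ^ 2 / (p * (p - polyRho F p)) := by
        field_simp; ring
      rw [e]
      refine ⟨by positivity, ?_⟩
      rw [mul_one_div, div_le_div_iff₀ (by positivity) (by positivity)]
      have h4 : (polyRho F p : ℝ) ^ 2 ≤ g ^ 2 := by gcongr
      calc (polyRho F p : ℝ) ^ 2 * (p : ℝ) ^ 2 ≤ (g : ℝ) ^ 2 * (p : ℝ) ^ 2 := by gcongr
        _ = 2 * (g : ℝ) ^ 2 * ((p : ℝ) * (p / 2)) := by ring
        _ ≤ _ := by gcongr; linarith
    have hs1 := Finset.sum_nonneg fun p hp => (hbd p hp).1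
    have hs2 := (Finset.sum_le_sum fun p hp => (hbd p hp).2)
    rw [← Finset.mul_sum] at hs2
    have hs3 := hs2.trans (mul_le_mul_of_nonneg_left
      (hsq.sum_le_tsum ((Finset.Ioc D n).filter Nat.Prime) fun n _ => by positivity)
      (by positivity))
    rw [Finset.sum_sub_distrib] at hs1 hs3
    have h5 := abs_le.1 hn
    have h6 := neg_abs_le A
    have h7 := le_abs_self A
    have h8 : (0 : ℝ) ≤ 2 * g ^ 2 * ∑' n : ℕ, 1 / (n : ℝ) ^ 2 :=
      mul_nonneg (by positivity) (tsum_nonneg fun _ => by positivity)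
    rw [hE, abs_le]
    constructor <;> linarith [h5.1, h5.2]
  obtain ⟨n₀, hn₀⟩ := eventually_atTop.1 hev
  refine ⟨D, |C₁ + |A| + 2 * g ^ 2 * ∑' n : ℕ, 1 / (n : ℝ) ^ 2| +
    ∑ m ∈ Finset.range n₀, |E m|, by omega, ?_, ?_⟩
  · intro p hp hDp'
    obtain ⟨-, h2, h3⟩ := hDp p hp hDp'
    omega
  · intro n
    change |E n| ≤ _
    have hpos : 0 ≤ ∑ m ∈ Finset.range n₀, |E m| := Finset.sum_nonneg fun _ _ => abs_nonneg _
    rcases le_or_gt n₀ n with h | h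
    · have := hn₀ n h
      have := le_abs_self (C₁ + |A| + 2 * g ^ 2 * ∑' n : ℕ, 1 / (n : ℝ) ^ 2)
      linarith
    · have := Finset.single_le_sum (f := fun m => |E m|) (fun _ _ => abs_nonneg _)
        (Finset.mem_range.2 h)
      have := abs_nonneg (C₁ + |A| + 2 * g ^ 2 * ∑' n : ℕ, 1 / (n : ℝ) ^ 2)
      linarith

end

theorem Lfun_mul_le {b c : ℕ} (hb : 0 < b) (hc : 0 < c) {η : ℝ} (hη : 0 ≤ η) :
    Lfun (b * c) η ≤ c.divisors.card * (log b + η) := by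
  have hsub : {x : ℝ | ∃ d : ℕ, d ∣ b * c ∧ exp x < (d : ℝ) ∧ (d : ℝ) ≤ exp (x + η)} ⊆
      ⋃ d ∈ c.divisors, Set.Icc (log d - η) (log d + log b) := by
    rintro x ⟨d, hd, h1, h2⟩
    obtain ⟨d₁, d₂, hd₁, hd₂, rfl⟩ := (Nat.dvd_mul).1 hd
    have h₁ : 0 < d₁ := Nat.pos_of_dvd_of_pos hd₁ hb
    have h₂ : 0 < d₂ := Nat.pos_of_dvd_of_pos hd₂ hc
    have h₁' : (1 : ℝ) ≤ d₁ := by exact_mod_cast h₁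
    have h₂' : (0 : ℝ) < d₂ := by exact_mod_cast h₂
    have hle : log d₁ ≤ log b := log_le_log (by linarith) (by exact_mod_cast Nat.le_of_dvd hb hd₁)
    have h0 : 0 ≤ log d₁ := log_nonneg h₁'
    push_cast at h1 h2
    rw [← lt_log_iff_exp_lt (by positivity), log_mul (by positivity) (by positivity)] at h1
    rw [← log_le_iff_le_exp (by positivity), log_mul (by positivity) (by positivity)] at h2
    simp only [Set.mem_iUnion, Set.mem_Icc]
    exact ⟨d₂, Nat.mem_divisors.2 ⟨hd₂, hc.ne'⟩, by linarith, by linarith⟩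
  have hb0 : 0 ≤ log (b : ℝ) := log_natCast_nonneg b
  have hm : volume (⋃ d ∈ c.divisors, Set.Icc (log (d : ℝ) - η) (log d + log b)) ≤
      ENNReal.ofReal (c.divisors.card * (log b + η)) := by
    refine (measure_biUnion_finset_le _ _).trans ?_
    simp only [volume_Icc]
    rw [ENNReal.ofReal_mul (by positivity), ENNReal.ofReal_natCast, ← nsmul_eq_mul,
      ← Finset.sum_const]
    refine Finset.sum_le_sum fun d _ => ENNReal.ofReal_le_ofReal (by linarith)
  rw [Lfun]
  exact ENNReal.toReal_le_of_le_ofReal (by positivity) ((measure_mono hsub).trans hm)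

theorem polyRho_mul_le (F : Polynomial ℤ) {m n : ℕ} (hm : 0 < m) (hn : 0 < n)
    (h : m.Coprime n) : polyRho F (m * n) ≤ polyRho F m * polyRho F n := by
  have key : ∀ (d e x : ℕ), d ∣ e → (e : ℤ) ∣ F.eval (x : ℤ) →
      (d : ℤ) ∣ F.eval ((x % d : ℕ) : ℤ) := by
    intro d e x hde hx
    have h1 : (d : ℤ) ∣ F.eval (x : ℤ) := (Int.natCast_dvd_natCast.2 hde).trans hx
    have h2 : (d : ℤ) ∣ F.eval (x : ℤ) - F.eval ((x % d : ℕ) : ℤ) := by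
      refine dvd_trans ?_ (Polynomial.sub_dvd_eval_sub _ _ F)
      rw [Int.natCast_mod]
      exact Int.dvd_self_sub_emod
    exact (dvd_sub_right h1).1 h2
  simp only [polyRho_eq_card_filter]
  rw [← Finset.card_product]
  refine Finset.card_le_card_of_injOn (fun x => (x % m, x % n)) ?_ ?_
  · intro x hx
    simp only [Finset.coe_filter, Finset.mem_range, Set.mem_ofPred_eq] at hx
    simp only [Finset.coe_product, Set.mem_prod, Finset.coe_filter, Finset.mem_range,
      Set.mem_ofPred_eq]
    exact ⟨⟨Nat.mod_lt _ hm, key _ _ _ (Dvd.intro _ rfl) hx.2⟩,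
      ⟨Nat.mod_lt _ hn, key _ _ _ (Dvd.intro_left _ rfl) hx.2⟩⟩
  · intro x hx y hy hxy
    simp only [Finset.coe_filter, Finset.mem_range, Set.mem_ofPred_eq] at hx hy
    simp only [Prod.mk.injEq] at hxy
    have : x ≡ y [MOD m * n] := (Nat.modEq_and_modEq_iff_modEq_mul h).1 hxy
    rw [Nat.ModEq, Nat.mod_eq_of_lt hx.1, Nat.mod_eq_of_lt hy.1] at this
    exact this

theorem polyRho_prod_primes_le (F : Polynomial ℤ) (A : Finset ℕ) (hA : ∀ p ∈ A, p.Prime) :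
    polyRho F (∏ p ∈ A, p) ≤ ∏ p ∈ A, polyRho F p := by
  induction A using Finset.induction_on with
  | empty =>
    rw [Finset.prod_empty, Finset.prod_empty, polyRho_eq_card_filter]
    exact (Finset.card_filter_le _ _).trans (by simp)
  | insert p A hp ih =>
    have hA' : ∀ q ∈ A, q.Prime := fun q hq => hA q (Finset.mem_insert_of_mem hq)
    have hpp := hA p (Finset.mem_insert_self _ _)
    rw [Finset.prod_insert hp, Finset.prod_insert hp]
    refine (polyRho_mul_le F hpp.pos (Finset.prod_pos fun q hq => (hA' q hq).pos) ?_).trans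
      (Nat.mul_le_mul_left _ (ih hA'))
    refine Nat.Coprime.prod_right fun q hq => (Nat.coprime_primes hpp (hA' q hq)).2 ?_
    rintro rfl
    exact hp hq

theorem polyRho_div_polyPhi_le (F : Polynomial ℤ) {a : ℕ} (ha : Squarefree a)
    (h : ∀ p : ℕ, p.Prime → p ∣ a → polyRho F p < p) :
    (polyRho F a : ℝ) / polyPhi F a ≤ ∏ p ∈ a.primeFactors, rootWeight F p := by
  have hpr : ∏ p ∈ a.primeFactors, p = a := Nat.prod_primeFactors_of_squarefree ha
  have hpos : ∀ p ∈ a.primeFactors, 0 < (p : ℝ) - polyRho F p := by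
    intro p hp
    have := h p (Nat.prime_of_mem_primeFactors hp) (Nat.dvd_of_mem_primeFactors hp)
    rw [sub_pos]
    exact_mod_cast this
  have hphi : polyPhi F a = ∏ p ∈ a.primeFactors, ((p : ℝ) - polyRho F p) := by
    rw [polyPhi]
    nth_rewrite 1 [← hpr]
    push_cast
    rw [← Finset.prod_mul_distrib]
    refine Finset.prod_congr rfl fun p hp => ?_
    have : (p : ℝ) ≠ 0 := by exact_mod_cast (Nat.prime_of_mem_primeFactors hp).ne_zero
    field_simp
  rw [hphi]
  simp only [rootWeight]
  rw [Finset.prod_div_distrib]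
  refine div_le_div_of_nonneg_right ?_ (Finset.prod_nonneg fun p hp => (hpos p hp).le)
  have := polyRho_prod_primes_le F a.primeFactors fun p hp => Nat.prime_of_mem_primeFactors hp
  rw [hpr] at this
  exact_mod_cast this

/-- The `i`-th element, in increasing order, of a set of natural numbers with `k` elements. -/
noncomputable def increasingEnum (A : Finset ℕ) (k : ℕ) (i : Fin k) : ℕ :=
  if h : A.card = k then A.orderEmbOfFin h i else 0

theorem increasingEnum_strictMono {A : Finset ℕ} {k : ℕ} (h : A.card = k) :
    StrictMono (increasingEnum A k) := by
  intro i j hij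
  simp only [increasingEnum, h, dif_pos]
  exact (A.orderEmbOfFin h).strictMono hij

theorem image_increasingEnum {A : Finset ℕ} {k : ℕ} (h : A.card = k) :
    Finset.univ.image (increasingEnum A k) = A := by
  have : increasingEnum A k = A.orderEmbOfFin h := by
    funext i
    simp only [increasingEnum, h, dif_pos]
  rw [this]
  exact A.image_orderEmbOfFin_univ h

theorem increasingEnum_mem {A : Finset ℕ} {k : ℕ} (h : A.card = k) (i : Fin k) :
    increasingEnum A k i ∈ A := by
  have := Finset.mem_image_of_mem (increasingEnum A k) (Finset.mem_univ i)
  rwa [image_increasingEnum h] at this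

theorem prod_increasingEnum {R : Type*} [CommMonoid R] {A : Finset ℕ} {k : ℕ} (h : A.card = k)
    (f : ℕ → R) : ∏ i, f (increasingEnum A k i) = ∏ p ∈ A, f p := by
  conv_rhs => rw [← image_increasingEnum h]
  rw [Finset.prod_image fun _ _ _ _ h' => (increasingEnum_strictMono h).injective h']

theorem card_divisors_prod_primes_le {ι : Type*} (S : Finset ι) (f : ι → ℕ)
    (hf : ∀ i ∈ S, (f i).Prime) : (∏ i ∈ S, f i).divisors.card ≤ 2 ^ S.card := by
  induction S using Finset.induction_on with
  | empty => simp
  | insert i S hi ih =>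
    have h1 := hf i (Finset.mem_insert_self _ _)
    rw [Finset.prod_insert hi, Nat.divisors_mul, Finset.card_insert_of_notMem hi, pow_succ']
    refine Finset.card_mul_le.trans (Nat.mul_le_mul ?_
      (ih fun j hj => hf j (Finset.mem_insert_of_mem hj)))
    rw [h1.divisors]
    exact Finset.card_le_two

theorem Lfun_prod_primes_le {A : Finset ℕ} {k : ℕ} (h : A.card = k) (hA : ∀ p ∈ A, p.Prime)
    {η : ℝ} (hη : 0 ≤ η) {j : ℕ} (hj : j ≤ k) :
    Lfun (∏ p ∈ A, p) η ≤ 2 ^ k * (((2 : ℝ) ^ j)⁻¹ *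
      ((∑ i : Fin k, if (i : ℕ) < j then log (increasingEnum A k i) else 0) + η)) := by
  have hpr : ∀ i, (increasingEnum A k i).Prime := fun i => hA _ (increasingEnum_mem h i)
  have hsplit := Finset.prod_filter_mul_prod_filter_not (Finset.univ : Finset (Fin k))
    (fun i => (i : ℕ) < j) (increasingEnum A k)
  have hall := prod_increasingEnum h (fun p => p)
  rw [← hall, ← hsplit]
  refine (Lfun_mul_le (Finset.prod_pos fun i _ => (hpr i).pos)
    (Finset.prod_pos fun i _ => (hpr i).pos) hη).trans ?_
  have hcard : (Finset.univ.filter (fun i : Fin k => ¬ (i : ℕ) < j)).card = k - j := by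
    have h1 := Finset.card_filter_add_card_filter_not (s := (Finset.univ : Finset (Fin k)))
      (fun i => (i : ℕ) < j)
    have h2 : (Finset.univ.filter (fun i : Fin k => (i : ℕ) < j)).card = j := by
      rw [Fin.card_filter_val_lt]
      omega
    rw [Finset.card_univ, Fintype.card_fin] at h1
    omega
  have hd := card_divisors_prod_primes_le (Finset.univ.filter (fun i : Fin k => ¬ (i : ℕ) < j))
    (increasingEnum A k) fun i _ => hpr i
  rw [hcard] at hd
  have hlog : log ((∏ i ∈ Finset.univ.filter (fun i : Fin k => (i : ℕ) < j),
      increasingEnum A k i : ℕ) : ℝ) =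
      ∑ i : Fin k, if (i : ℕ) < j then log (increasingEnum A k i) else 0 := by
    rw [Nat.cast_prod, log_prod fun i _ => by exact_mod_cast (hpr i).ne_zero,
      Finset.sum_filter]
  rw [hlog, ← mul_assoc, ← pow_sub₀ _ two_ne_zero hj]
  refine mul_le_mul_of_nonneg_right (by exact_mod_cast hd) (add_nonneg ?_ hη)
  refine Finset.sum_nonneg fun i _ => ?_
  split_ifs
  · exact log_natCast_nonneg _
  · exact le_rfl

/-- The interval attached to `p` when the mass `w` on `P`, scaled by `M⁻¹`, is laid out along the
real line in increasing order. -/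
def massInterval (P : Finset ℕ) (w : ℕ → ℝ) (M : ℝ) (p : ℕ) : Set ℝ :=
  Set.Ioc ((∑ q ∈ P.filter (· < p), w q) / M) ((∑ q ∈ P.filter (· ≤ p), w q) / M)

section massInterval

variable {P : Finset ℕ} {w : ℕ → ℝ} {M : ℝ}

theorem lt_of_mem_massInterval (hw : ∀ p ∈ P, 0 ≤ w p) (hM : 0 < M) {p q : ℕ} (hpq : p < q)
    {x y : ℝ} (hx : x ∈ massInterval P w M p) (hy : y ∈ massInterval P w M q) : x < y := by
  refine hx.2.trans_lt (lt_of_le_of_lt ?_ hy.1)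
  refine div_le_div_of_nonneg_right (Finset.sum_le_sum_of_subset_of_nonneg ?_ ?_) hM.le
  · intro m hm
    rw [Finset.mem_filter] at hm ⊢
    exact ⟨hm.1, hm.2.trans_lt hpq⟩
  · intro m hm _
    exact hw m (Finset.mem_filter.1 hm).1

theorem eq_of_mem_massInterval (hw : ∀ p ∈ P, 0 ≤ w p) (hM : 0 < M) {p q : ℕ}
    {x : ℝ} (hx : x ∈ massInterval P w M p) (hy : x ∈ massInterval P w M q) : p = q := by
  rcases lt_trichotomy p q with h | h | h
  · exact absurd (lt_of_mem_massInterval hw hM h hx hy) (lt_irrefl _)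
  · exact h
  · exact absurd (lt_of_mem_massInterval hw hM h hy hx) (lt_irrefl _)

theorem massInterval_subset (hw : ∀ p ∈ P, 0 ≤ w p) (hM : 0 < M) (hWM : ∑ p ∈ P, w p ≤ M)
    (p : ℕ) : massInterval P w M p ⊆ Set.Icc 0 1 := by
  intro x hx
  refine ⟨le_trans (div_nonneg (Finset.sum_nonneg fun q hq => ?_) hM.le) hx.1.le, hx.2.trans ?_⟩
  · exact hw q (Finset.mem_filter.1 hq).1
  · rw [div_le_one hM]
    refine (Finset.sum_le_sum_of_subset_of_nonneg (Finset.filter_subset _ _) ?_).trans hWM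
    exact fun q hq _ => hw q hq

theorem measureReal_massInterval (hw : ∀ p ∈ P, 0 ≤ w p) (hM : 0 < M) {p : ℕ} (hp : p ∈ P) :
    volume.real (massInterval P w M p) = w p / M := by
  have : P.filter (· ≤ p) = insert p (P.filter (· < p)) := by
    ext m
    simp only [Finset.mem_filter, Finset.mem_insert]
    constructor
    · rintro ⟨h1, h2⟩
      rcases h2.eq_or_lt with h | h
      · exact Or.inl h
      · exact Or.inr ⟨h1, h⟩
    · rintro (rfl | ⟨h1, h2⟩)
      · exact ⟨hp, le_rfl⟩
      · exact ⟨h1, h2.le⟩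
  rw [massInterval, this, Finset.sum_insert (by simp), Real.volume_real_Ioc_of_le]
  · rw [← sub_div, add_sub_cancel_right]
  · exact div_le_div_of_nonneg_right (by linarith [hw p hp]) hM.le

theorem sum_powersetCard_prod_mul_le (hw : ∀ p ∈ P, 0 ≤ w p) (hM : 0 < M)
    (hWM : ∑ p ∈ P, w p ≤ M) (k : ℕ) (c : Finset ℕ → ℝ) (f : (Fin k → ℝ) → ℝ)
    (hf0 : ∀ ξ, 0 ≤ f ξ) (hf : Continuous f)
    (hc : ∀ A ∈ P.powersetCard k, ∀ ξ : Fin k → ℝ,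
      (∀ i, ξ i ∈ massInterval P w M (increasingEnum A k i)) → c A ≤ f ξ) :
    ∑ A ∈ P.powersetCard k, (∏ p ∈ A, w p) * c A ≤ M ^ k *
      ∫ ξ in {ξ : Fin k → ℝ | (∀ i j : Fin k, i ≤ j → ξ i ≤ ξ j) ∧ ∀ i, 0 ≤ ξ i ∧ ξ i ≤ 1},
        f ξ := by
  set S : Set (Fin k → ℝ) :=
    {ξ : Fin k → ℝ | (∀ i j : Fin k, i ≤ j → ξ i ≤ ξ j) ∧ ∀ i, 0 ≤ ξ i ∧ ξ i ≤ 1} with hS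
  set box : Finset ℕ → Set (Fin k → ℝ) := fun A =>
    Set.pi Set.univ fun i => massInterval P w M (increasingEnum A k i) with hbox
  have hcard : ∀ A ∈ P.powersetCard k, A.card = k := fun A hA => (Finset.mem_powersetCard.1 hA).2
  have hsubP : ∀ A ∈ P.powersetCard k, A ⊆ P := fun A hA => (Finset.mem_powersetCard.1 hA).1
  have hInt : ∀ T ⊆ Set.Icc (0 : Fin k → ℝ) 1, IntegrableOn f T := fun T hT =>
    (hf.continuousOn.integrableOn_compact isCompact_Icc).mono_set hT
  have hSsub : S ⊆ Set.Icc (0 : Fin k → ℝ) 1 := fun ξ hξ =>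
    ⟨fun i => (hξ.2 i).1, fun i => (hξ.2 i).2⟩
  have hmeas : ∀ A, MeasurableSet (box A) := fun A =>
    MeasurableSet.univ_pi fun i => measurableSet_Ioc
  have hboxS : ∀ A ∈ P.powersetCard k, box A ⊆ S := by
    intro A hA ξ hξ
    have hξ' : ∀ i, ξ i ∈ massInterval P w M (increasingEnum A k i) := fun i => hξ i trivial
    refine ⟨fun i j hij => ?_, fun i => massInterval_subset hw hM hWM _ (hξ' i)⟩
    rcases hij.eq_or_lt with rfl | hlt
    · exact le_rfl
    · exact (lt_of_mem_massInterval hw hM (increasingEnum_strictMono (hcard A hA) hlt)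
        (hξ' i) (hξ' j)).le
  have hdisj : Set.PairwiseDisjoint (P.powersetCard k : Set (Finset ℕ)) box := by
    intro A hA B hB hAB
    rw [Function.onFun, Set.disjoint_left]
    intro ξ hξA hξB
    refine hAB ?_
    rw [← image_increasingEnum (hcard A hA), ← image_increasingEnum (hcard B hB)]
    congr 1
    funext i
    exact eq_of_mem_massInterval hw hM (hξA i trivial) (hξB i trivial)
  have hterm : ∀ A ∈ P.powersetCard k,
      (∏ p ∈ A, w p) * c A ≤ M ^ k * ∫ ξ in box A, f ξ := by
    intro A hA
    have hvol : volume.real (box A) = (∏ p ∈ A, w p) / M ^ k := by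
      rw [measureReal_def, volume_pi_pi, ENNReal.toReal_prod]
      simp only [← measureReal_def]
      rw [Finset.prod_congr rfl fun i _ => measureReal_massInterval hw hM
        (hsubP A hA (increasingEnum_mem (hcard A hA) i)), Finset.prod_div_distrib,
        prod_increasingEnum (hcard A hA), Finset.prod_const, Finset.card_univ, Fintype.card_fin]
    have hfin : volume (box A) ≠ ⊤ := by
      rw [volume_pi_pi]
      exact ENNReal.prod_ne_top fun i _ => by simp [massInterval]
    have h1 := setIntegral_ge_of_const_le_real (hmeas A) hfin
      (fun ξ hξ => hc A hA ξ fun i => hξ i trivial) (hInt _ ((hboxS A hA).trans hSsub))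
    rw [hvol] at h1
    calc (∏ p ∈ A, w p) * c A = M ^ k * (c A * ((∏ p ∈ A, w p) / M ^ k)) := by
          field_simp
      _ ≤ _ := by gcongr
  refine (Finset.sum_le_sum hterm).trans ?_
  rw [← Finset.mul_sum, ← integral_biUnion_finset _ (fun A _ => hmeas A) hdisj
    fun A hA => hInt _ ((hboxS A hA).trans hSsub)]
  refine mul_le_mul_of_nonneg_left ?_ (by positivity)
  exact setIntegral_mono_set (hInt S hSsub) (Filter.Eventually.of_forall hf0)
    (Set.iUnion₂_subset hboxS).eventuallyLE

end massInterval

/-- The integrand in the definition of `Uk`. -/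
noncomputable def UkIntegrand (k : ℕ) (v t : ℝ) (ξ : Fin k → ℝ) : ℝ :=
  (Finset.range (k + 1)).inf' ⟨0, Finset.mem_range.mpr (Nat.succ_pos k)⟩
    (fun j => ((2 : ℝ) ^ j)⁻¹ *
      ((∑ i : Fin k, if (i : ℕ) < j then (2 : ℝ) ^ (v * ξ i) else 0) + t))

theorem continuous_UkIntegrand (k : ℕ) (v t : ℝ) : Continuous (UkIntegrand k v t) := by
  refine Continuous.finset_inf'_apply _ fun j _ => ?_
  refine continuous_const.mul (Continuous.add (continuous_finsetSum _ fun i _ => ?_)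
    continuous_const)
  split_ifs
  · exact Continuous.rpow continuous_const (by fun_prop) fun _ => Or.inl two_ne_zero
  · exact continuous_const

theorem UkIntegrand_nonneg (k : ℕ) (v : ℝ) {t : ℝ} (ht : 0 ≤ t) (ξ : Fin k → ℝ) :
    0 ≤ UkIntegrand k v t ξ := by
  refine Finset.le_inf' _ _ fun j _ => mul_nonneg (by positivity) (add_nonneg ?_ ht)
  refine Finset.sum_nonneg fun i _ => ?_
  split_ifs <;> positivity

theorem le_mul_add_one_mul_min {η : ℝ} (hη : 0 < η) : η ≤ (η + 1) * min 1 η := by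
  rcases le_total η 1 with h | h
  · rw [min_eq_right h]; nlinarith
  · rw [min_eq_left h]; linarith

theorem Lfun_prod_primes_le_UkIntegrand {A : Finset ℕ} {k : ℕ} (h : A.card = k)
    (hA : ∀ p ∈ A, p.Prime) {η B v : ℝ} (hη : 0 < η) (hB : 1 ≤ B) (ξ : Fin k → ℝ)
    (hξ : ∀ i, log (increasingEnum A k i) ≤ B * 2 ^ (v * ξ i)) :
    Lfun (∏ p ∈ A, p) η ≤ 2 ^ k * (B * (η + 1)) * UkIntegrand k v (min 1 η) ξ := by
  obtain ⟨j, hj, hj'⟩ := Finset.exists_mem_eq_inf'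
    ⟨0, Finset.mem_range.mpr (Nat.succ_pos k)⟩ (fun j => ((2 : ℝ) ^ j)⁻¹ *
      ((∑ i : Fin k, if (i : ℕ) < j then (2 : ℝ) ^ (v * ξ i) else 0) + min 1 η))
  rw [UkIntegrand, hj']
  have hjk : j ≤ k := by rw [Finset.mem_range] at hj; omega
  refine (Lfun_prod_primes_le h hA hη.le hjk).trans ?_
  rw [mul_assoc, mul_left_comm (B * (η + 1))]
  refine mul_le_mul_of_nonneg_left (mul_le_mul_of_nonneg_left ?_ (by positivity)) (by positivity)
  rw [mul_add, Finset.mul_sum]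
  refine add_le_add (Finset.sum_le_sum fun i _ => ?_) ?_
  · split_ifs
    · refine (hξ i).trans ?_
      have : 0 ≤ (2 : ℝ) ^ (v * ξ i) := by positivity
      nlinarith [mul_nonneg (mul_nonneg (zero_le_one.trans hB) hη.le) this]
    · simp
  · have h1 := le_mul_add_one_mul_min hη
    have h2 : 0 ≤ (η + 1) * min 1 η := hη.le.trans h1
    nlinarith

theorem squarefree_prod_primes {A : Finset ℕ} (hA : ∀ p ∈ A, p.Prime) :
    Squarefree (∏ p ∈ A, p) := by
  refine Finset.squarefree_prod_of_pairwise_isCoprime ?_ fun p hp => (hA p hp).squarefree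
  intro p hp q hq hpq
  exact Nat.coprime_iff_isRelPrime.1 ((Nat.coprime_primes (hA p hp) (hA q hq)).2 hpq)

theorem tsum_Psf_eq_sum_powersetCard (D : ℕ) {z : ℝ} (hz : 0 ≤ z) (k : ℕ) (f : ℕ → ℝ) :
    ∑' a : {a : ℕ | a ∈ Psf D z ∧ (a : ℕ).primeFactors.card = k}, f a =
      ∑ A ∈ ((Finset.Ioc D ⌊z⌋₊).filter Nat.Prime).powersetCard k, f (∏ p ∈ A, p) := by
  set P := (Finset.Ioc D ⌊z⌋₊).filter Nat.Prime with hP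
  have hpr : ∀ A ∈ P.powersetCard k, ∀ p ∈ A, p.Prime := fun A hA p hp =>
    (Finset.mem_filter.1 ((Finset.mem_powersetCard.1 hA).1 hp)).2
  have hset : {a : ℕ | a ∈ Psf D z ∧ (a : ℕ).primeFactors.card = k} =
      (((P.powersetCard k).image fun A => ∏ p ∈ A, p : Finset ℕ) : Set ℕ) := by
    ext a
    simp only [Finset.coe_image, Set.mem_image, Finset.mem_coe]
    constructor
    · rintro ⟨⟨h0, h1, h2⟩, h3⟩
      refine ⟨a.primeFactors, Finset.mem_powersetCard.2 ⟨fun p hp => ?_, h3⟩,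
        Nat.prod_primeFactors_of_squarefree h1⟩
      have hp' := Nat.prime_of_mem_primeFactors hp
      obtain ⟨h4, h5⟩ := h2 p hp' (Nat.dvd_of_mem_primeFactors hp)
      exact Finset.mem_filter.2 ⟨Finset.mem_Ioc.2 ⟨by exact_mod_cast h4, Nat.le_floor h5⟩, hp'⟩
    · rintro ⟨A, hA, rfl⟩
      have hpf := Nat.primeFactors_prod (hpr A hA)
      refine ⟨⟨Finset.prod_pos fun p hp => (hpr A hA p hp).pos,
        squarefree_prod_primes (hpr A hA), ?_⟩, ?_⟩
      · intro p hp hpd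
        have : p ∈ A := by
          rw [← hpf]
          exact Nat.mem_primeFactors.2
            ⟨hp, hpd, (Finset.prod_pos fun p hp => (hpr A hA p hp).pos).ne'⟩
        have := (Finset.mem_filter.1 ((Finset.mem_powersetCard.1 hA).1 this)).1
        rw [Finset.mem_Ioc] at this
        exact ⟨by exact_mod_cast this.1, (Nat.le_floor_iff hz).1 this.2⟩
      · rw [hpf]
        exact (Finset.mem_powersetCard.1 hA).2
  rw [hset, Finset.tsum_subtype', Finset.sum_image]
  intro A hA B hB hAB
  rw [← Nat.primeFactors_prod (hpr A hA), ← Nat.primeFactors_prod (hpr B hB)]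
  exact congrArg _ hAB

theorem add_pow_le_mul_exp {v c : ℝ} (hv : 0 < v) (hc : 0 ≤ c) {k : ℕ} (hk : (k : ℝ) ≤ 10 * v) :
    (v + c) ^ k ≤ v ^ k * exp (10 * c) := by
  have h1 : v + c = v * (c / v + 1) := by field_simp; ring
  rw [h1, mul_pow]
  refine mul_le_mul_of_nonneg_left ?_ (by positivity)
  calc (c / v + 1) ^ k ≤ exp (c / v) ^ k := by
        gcongr
        exact add_one_le_exp _
    _ = exp (k * (c / v)) := (exp_nat_mul _ _).symm
    _ ≤ exp (10 * c) := by
        refine exp_le_exp.2 ?_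
        calc (k : ℝ) * (c / v) ≤ 10 * v * (c / v) := by gcongr
          _ = 10 * c := by field_simp

theorem stmt16 (F : Polynomial ℤ) (hF : Irreducible F) (hdeg : 2 ≤ F.natDegree) :
    ∃ (D z₀ K : ℝ), 2 ≤ D ∧ 0 < K ∧
      (∀ p : ℕ, p.Prime → D < (p : ℝ) → polyRho F p < p) ∧
      ∀ z η : ℝ, z₀ ≤ z → 0 < η → η ≤ Real.log z →
        ∀ (v : ℤ) (k : ℕ), v = ⌈Real.log (Real.log z) / Real.log 2⌉ →
          (k : ℤ) ≤ 10 * v →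
          ∑' a : {a : ℕ | a ∈ Psf D z ∧ (a : ℕ).primeFactors.card = k},
            Lfun a η * (polyRho F a : ℝ) / polyPhi F a ≤
          K * (η + 1) * (2 * (v : ℝ) * Real.log 2) ^ k * Uk k (v : ℝ) (min 1 η) := by
  obtain ⟨D, C, hD2, hDρ, hC⟩ := exists_abs_sum_rootWeight_sub_log_log_le F hF (by omega)
  have hC0 : 0 ≤ C := (abs_nonneg _).trans (hC 0)
  have hl2 : 0 < log 2 := log_pos one_lt_two
  set c := C / log 2 with hcdef
  have hc0 : 0 ≤ c := div_nonneg hC0 hl2.le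
  set B := exp (C + 1) * 2 ^ c with hBdef
  have hB : 1 ≤ B := one_le_mul_of_one_le_of_one_le (one_le_exp (by linarith))
    (one_le_rpow one_le_two hc0)
  have hw0 : ∀ p : ℕ, p.Prime → D < p → 0 ≤ rootWeight F p ∧ rootWeight F p ≤ 1 := by
    intro p hp hDp
    have h1 : 2 * (polyRho F p : ℝ) ≤ p := by exact_mod_cast hDρ p hp hDp
    have h2 : (0 : ℝ) < p := by exact_mod_cast hp.pos
    have h3 : (0 : ℝ) < p - polyRho F p := by linarith
    refine ⟨div_nonneg (Nat.cast_nonneg _) h3.le, ?_⟩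
    rw [rootWeight, div_le_one h3]
    linarith
  refine ⟨D, exp (exp 1), B * exp (10 * c), by exact_mod_cast hD2, by positivity, ?_, ?_⟩
  · intro p hp hDp
    have := hDρ p hp (by exact_mod_cast hDp)
    have := hp.pos
    omega
  intro z η hz hη _ v k hv hk
  have hz0 : 0 < z := (exp_pos _).trans_le hz
  have hlz : exp 1 ≤ log z := (le_log_iff_exp_le hz0).2 hz
  have hlz0 : 0 < log z := (exp_pos _).trans_le hlz
  have hllz : 1 ≤ log (log z) := (le_log_iff_exp_le hlz0).2 hlz
  have hvle : log (log z) ≤ v * log 2 := by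
    rw [← div_le_iff₀ hl2, hv]
    exact Int.le_ceil _
  have hv0 : (0 : ℝ) < v := by
    by_contra! h
    nlinarith
  set n := ⌊z⌋₊ with hn
  set P := (Finset.Ioc D n).filter Nat.Prime with hP
  have hPw : ∀ p ∈ P, 0 ≤ rootWeight F p := fun p hp => by
    rw [hP, Finset.mem_filter, Finset.mem_Ioc] at hp
    exact (hw0 p hp.2 hp.1.1).1
  set M := (v + c) * log 2 with hM
  have hM0 : 0 < M := by positivity
  have hz2 : 2 ≤ z := by
    have h1 := add_one_le_exp (1 : ℝ)
    have h2 := add_one_le_exp (exp 1)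
    linarith
  have hn2 : 2 ≤ n := Nat.le_floor (by exact_mod_cast hz2)
  have hWM : ∑ p ∈ P, rootWeight F p ≤ M := by
    have h1 := (abs_le.1 (hC n)).2
    have hn1 : (1 : ℝ) < n := by exact_mod_cast hn2
    have h2 : log (log n) ≤ log (log z) :=
      log_le_log (log_pos hn1) (log_le_log (by linarith) (Nat.floor_le hz0.le))
    have h3 : M = v * log 2 + C := by rw [hM, hcdef]; field_simp
    rw [h3]
    linarith
  have hlow : ∀ p ∈ P, ∀ x ∈ massInterval P (rootWeight F) M p,
      log p ≤ B * 2 ^ ((v : ℝ) * x) := by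
    intro p hp x hx
    have hx1 := massInterval_subset hPw hM0 hWM p hx
    have hp' := hp
    rw [hP, Finset.mem_filter, Finset.mem_Ioc] at hp'
    have hsum : ∑ q ∈ (Finset.Ioc D p).filter Nat.Prime, rootWeight F q =
        rootWeight F p + ∑ q ∈ P.filter (· < p), rootWeight F q := by
      rw [← Finset.sum_insert (by simp)]
      congr 1
      ext m
      simp only [hP, Finset.mem_filter, Finset.mem_insert, Finset.mem_Ioc]
      constructor
      · rintro ⟨⟨h1, h2⟩, h3⟩
        rcases h2.eq_or_lt with h | h
        · exact Or.inl h
        · exact Or.inr ⟨⟨⟨h1, by omega⟩, h3⟩, h⟩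
      · rintro (rfl | ⟨⟨⟨h1, h2⟩, h3⟩, h4⟩)
        · exact ⟨⟨hp'.1.1, le_rfl⟩, hp'.2⟩
        · exact ⟨⟨h1, h4.le⟩, h3⟩
    have h1 := (abs_le.1 (hC p)).1
    rw [hsum] at h1
    have h2 := (hw0 p hp'.2 hp'.1.1).2
    have h3 := (div_lt_iff₀ hM0).1 hx.1
    have hlp : 0 < log (p : ℝ) := log_pos (by exact_mod_cast hp'.2.one_lt)
    rw [← exp_log hlp, hBdef, rpow_def_of_pos two_pos, rpow_def_of_pos two_pos, ← exp_add,
      ← exp_add, exp_le_exp]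
    have h4 : x * M ≤ log 2 * c + log 2 * (v * x) := by
      have := mul_le_mul_of_nonneg_left hx1.2 (mul_nonneg hl2.le hc0)
      rw [hM]
      linarith
    linarith
  rw [tsum_Psf_eq_sum_powersetCard D hz0.le k
    (fun a => Lfun a η * (polyRho F a : ℝ) / polyPhi F a)]
  have hmain := sum_powersetCard_prod_mul_le hPw hM0 hWM k (fun A => Lfun (∏ p ∈ A, p) η)
    (fun ξ => 2 ^ k * (B * (η + 1)) * UkIntegrand k v (min 1 η) ξ)
    (fun ξ => mul_nonneg (by positivity) (UkIntegrand_nonneg _ _ (by positivity) _))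
    (continuous_const.mul (continuous_UkIntegrand _ _ _))
    (fun A hA ξ hξ => by
      obtain ⟨hAP, hAk⟩ := Finset.mem_powersetCard.1 hA
      exact Lfun_prod_primes_le_UkIntegrand hAk (fun p hp => (Finset.mem_filter.1 (hAP hp)).2)
        hη hB ξ fun i => hlow _ (hAP (increasingEnum_mem hAk i)) _ (hξ i))
  rw [integral_const_mul] at hmain
  have hU : Uk k (v : ℝ) (min 1 η) = ∫ ξ in {ξ : Fin k → ℝ |
      (∀ i j : Fin k, i ≤ j → ξ i ≤ ξ j) ∧ ∀ i, 0 ≤ ξ i ∧ ξ i ≤ 1},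
      UkIntegrand k v (min 1 η) ξ := rfl
  have hU0 : 0 ≤ Uk k (v : ℝ) (min 1 η) := by
    rw [hU]
    exact integral_nonneg fun ξ => UkIntegrand_nonneg _ _ (by positivity) _
  rw [← hU] at hmain
  have hMk : M ^ k ≤ v ^ k * exp (10 * c) * log 2 ^ k := by
    rw [hM, mul_pow]
    exact mul_le_mul_of_nonneg_right
      (add_pow_le_mul_exp hv0 hc0 (by exact_mod_cast hk)) (by positivity)
  calc _ ≤ ∑ A ∈ P.powersetCard k, (∏ p ∈ A, rootWeight F p) * Lfun (∏ p ∈ A, p) η := by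
        refine Finset.sum_le_sum fun A hA => ?_
        obtain ⟨hAP, hAk⟩ := Finset.mem_powersetCard.1 hA
        have hApr : ∀ p ∈ A, p.Prime := fun p hp => (Finset.mem_filter.1 (hAP hp)).2
        have hpf := Nat.primeFactors_prod hApr
        have hsq : Squarefree (∏ p ∈ A, p) := squarefree_prod_primes hApr
        have h1 := polyRho_div_polyPhi_le F hsq fun p hp hpd => by
          have hpA : p ∈ A := by
            rw [← hpf]
            exact Nat.mem_primeFactors.2 ⟨hp, hpd, hsq.ne_zero⟩
          have := hDρ p hp (Finset.mem_Ioc.1 (Finset.mem_filter.1 (hAP hpA)).1).1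
          have := hp.pos
          omega
        rw [hpf] at h1
        rw [mul_div_assoc, mul_comm]
        exact mul_le_mul_of_nonneg_right h1 ENNReal.toReal_nonneg
    _ ≤ M ^ k * (2 ^ k * (B * (η + 1)) * Uk k v (min 1 η)) := hmain
    _ ≤ v ^ k * exp (10 * c) * log 2 ^ k * (2 ^ k * (B * (η + 1)) * Uk k v (min 1 η)) := by
        gcongr
    _ = _ := by
        rw [mul_pow, mul_pow]
        ring
end
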